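/- arXiv:1003.1659 — 2 statements merged into one kernel-verified Lean document; each statement's English description precedes it below -/
import Mathlib

section
/- Let k be a finite field of cardinality q, let n and r be natural numbers with r ≥ 1, and let f_1, …, f_r be homogeneous polynomials in n+1 variables over k of degrees d_1, …, d_r respectively, with each d_j ≥ 1 and d_1 + … + d_r ≤ n. Then the number of points of the projective variety X = {f_1 = … = f_r = 0} in P^n(k) — that is, the number of equivalence classes, under scalar multiplication by k^*, of nonzero vectors x ∈ k^{n+1} with f_1(x) = … = f_r(x) = 0 — is congruent to 1 modulo q. -/
open Finset in
theorem sum_range_pow_add_mod (p f c : ℕ) :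
    ∑ l ∈ range f, p ^ ((l + c) % f) = ∑ l ∈ range f, p ^ l := by
  induction c with
  | zero => exact sum_congr rfl fun l hl => by rw [add_zero, Nat.mod_eq_of_lt (mem_range.1 hl)]
  | succ c ih =>
    rw [← ih]
    have h := (sum_range_succ' (fun l => p ^ ((l + c) % f)) f).symm.trans
      (sum_range_succ (fun l => p ^ ((l + c) % f)) f)
    simp only [zero_add, Nat.add_mod_left, add_left_inj] at h
    rw [← h]
    exact sum_congr rfl fun l _ => by rw [add_assoc, add_comm c 1]

/-- The cyclic shifts modulo `p ^ f - 1` of a natural number `m`, obtained by folding its base `p`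
digits; their sum is governed by the digit sum of `m`. -/
theorem exists_cyclic_shifts {p : ℕ} (hp : 1 < p) (f m : ℕ) :
    ∃ R : ℕ → ℕ, (∀ l, R l ≡ p ^ l * m [MOD p ^ f - 1]) ∧ (∀ l, m ≠ 0 → R l ≠ 0) ∧
      ∀ c, ∑ l ∈ Finset.range f, R (l + c) =
        (p.digits m).sum * ∑ l ∈ Finset.range f, p ^ l := by
  induction m using Nat.strong_induction_on with
  | _ m ih =>
    rcases Nat.eq_zero_or_pos m with rfl | hm
    · exact ⟨fun _ => 0, fun l => by simp [Nat.ModEq.refl], by simp, by simp⟩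
    obtain ⟨R, hR, hR0, hRs⟩ := ih (m / p) (Nat.div_lt_self hm hp)
    refine ⟨fun l => m % p * p ^ (l % f) + R (l + 1), fun l => ?_, fun l _ h => ?_, fun c => ?_⟩
    · have h1 : p ^ (l % f) ≡ p ^ l [MOD p ^ f - 1] := by
        have hpf : p ^ f ≡ 1 [MOD p ^ f - 1] :=
          ((Nat.modEq_iff_dvd' (Nat.one_le_pow _ _ (by lia))).2 dvd_rfl).symm
        conv_rhs => rw [← Nat.mod_add_div l f, pow_add, pow_mul]
        simpa using ((hpf.pow (l / f)).mul_left (p ^ (l % f))).symm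
      have h2 : p ^ l * m = m % p * p ^ l + p ^ (l + 1) * (m / p) := by
        conv_lhs => rw [← Nat.mod_add_div m p]
        ring
      rw [h2]
      exact (h1.mul_left _).add (hR _)
    · rcases Nat.add_eq_zero_iff.1 h with ⟨ha, hb⟩
      have h3 : m % p = 0 := (Nat.mul_eq_zero.1 ha).resolve_right (by positivity)
      refine hR0 _ (fun h4 => ?_) hb
      have := Nat.mod_add_div m p
      simp [h3, h4] at this
      lia
    · have h := hRs (c + 1)
      rw [Nat.digits_def' hp hm, List.sum_cons, add_mul, ← h, Finset.sum_add_distrib,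
        ← Finset.mul_sum, sum_range_pow_add_mod]
      simp only [add_assoc]

theorem sum_digits_pow_sub_one {p : ℕ} (hp : 1 < p) (f : ℕ) :
    (p.digits (p ^ f - 1)).sum = f * (p - 1) := by
  induction f with
  | zero => simp
  | succ f ih =>
    have h : p ^ (f + 1) - 1 = (p - 1) + p * (p ^ f - 1) := by
      have := Nat.one_le_pow f p (by lia)
      zify [this, Nat.one_le_pow (f + 1) p (by lia), hp.le]
      ring
    rw [h, Nat.digits_add p hp _ _ (by lia) (Or.inl (by lia)), List.sum_cons, ih]
    ring

/-- If every coordinate of `∑ i, m i • e i` is a positive multiple of `q - 1`, where `q = p ^ f`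
and the `e i` have total degree less than the number of coordinates, and `∑ i, m i` is a multiple
of `q - 1`, then the base `p` digit sums of the `m i` add up to at least `2 f (p - 1)`. -/
theorem two_mul_le_sum_digits_sum {p f : ℕ} (hp : 1 < p) (hf : f ≠ 0) {ι σ : Type*} [Fintype σ]
    [Nonempty σ] (s : Finset ι) (m : ι → ℕ) (e : ι → σ → ℕ)
    (he : ∀ i ∈ s, ∑ j, e i j < Fintype.card σ)
    (hm : p ^ f - 1 ∣ ∑ i ∈ s, m i)
    (hE : ∀ j, p ^ f - 1 ∣ ∑ i ∈ s, m i * e i j) (hE0 : ∀ j, ∑ i ∈ s, m i * e i j ≠ 0) :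
    2 * (f * (p - 1)) ≤ ∑ i ∈ s, (p.digits (m i)).sum := by
  choose R hR hR0 hRs using fun i => exists_cyclic_shifts hp f (m i)
  have hq : 1 < p ^ f := Nat.one_lt_pow hf hp
  set Q := p ^ f - 1 with hQ
  have hsum (g : ι → ℕ) (l : ℕ) (hg : Q ∣ ∑ i ∈ s, m i * g i) : Q ∣ ∑ i ∈ s, R i l * g i := by
    have h : ∑ i ∈ s, R i l * g i ≡ p ^ l * ∑ i ∈ s, m i * g i [MOD Q] := by
      rw [Finset.mul_sum]
      exact Nat.ModEq.sum fun i _ => by simpa [mul_assoc] using (hR i l).mul_right (g i)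
    exact (h.dvd_iff dvd_rfl).2 (hg.mul_left _)
  have hl (l : ℕ) : 2 * Q ≤ ∑ i ∈ s, R i l := by
    obtain ⟨c, hc⟩ : Q ∣ ∑ i ∈ s, R i l := by simpa using hsum (fun _ => 1) l (by simpa using hm)
    have h1 (j : σ) : Q ≤ ∑ i ∈ s, R i l * e i j := by
      refine Nat.le_of_dvd (Nat.pos_of_ne_zero fun h => hE0 j ?_) (hsum (e · j) l (hE j))
      rw [Finset.sum_eq_zero_iff] at h ⊢
      intro i hi
      rcases Nat.mul_eq_zero.1 (h i hi) with h | h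
      · rw [not_imp_not.1 (hR0 i l) h, zero_mul]
      · rw [h, mul_zero]
    have h2 : Fintype.card σ * Q ≤ (Fintype.card σ - 1) * ∑ i ∈ s, R i l := by
      calc Fintype.card σ * Q = ∑ _j : σ, Q := by simp
        _ ≤ ∑ j, ∑ i ∈ s, R i l * e i j := Finset.sum_le_sum fun j _ => h1 j
        _ = ∑ i ∈ s, R i l * ∑ j, e i j := by
          rw [Finset.sum_comm]; simp only [Finset.mul_sum]
        _ ≤ ∑ i ∈ s, R i l * (Fintype.card σ - 1) :=
          Finset.sum_le_sum fun i hi => Nat.mul_le_mul_left _ (Nat.le_sub_one_of_lt (he i hi))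
        _ = _ := by rw [← Finset.sum_mul, mul_comm]
    rw [hc] at h2 ⊢
    have hσ : 0 < Fintype.card σ := Fintype.card_pos
    have h3 : Fintype.card σ ≤ (Fintype.card σ - 1) * c :=
      Nat.le_of_mul_le_mul_right (by linarith) (show 0 < Q by lia)
    have h4 : 2 ≤ c := by
      by_contra! h4
      have := Nat.mul_le_mul_left (Fintype.card σ - 1) (Nat.le_of_lt_succ h4)
      lia
    nlinarith
  have hgeom : (∑ l ∈ Finset.range f, p ^ l) * (p - 1) = Q := 
    geom_sum_mul_of_one_le hp.le f
  have htot : f * (2 * Q) ≤ (∑ i ∈ s, (p.digits (m i)).sum) * ∑ l ∈ Finset.range f, p ^ l := by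
    calc f * (2 * Q) = ∑ _l ∈ Finset.range f, 2 * Q := by simp
      _ ≤ ∑ l ∈ Finset.range f, ∑ i ∈ s, R i l := Finset.sum_le_sum fun l _ => hl l
      _ = _ := by
        rw [Finset.sum_comm, Finset.sum_mul]
        exact Finset.sum_congr rfl fun i _ => hRs i 0
  refine Nat.le_of_mul_le_mul_right ?_ (show 0 < ∑ l ∈ Finset.range f, p ^ l from ?_)
  · rw [← hgeom] at htot
    linarith
  · exact Nat.pos_of_ne_zero fun h => by simp [h] at hgeom; lia

theorem pow_dvd_multinomial {p f : ℕ} [hp : Fact p.Prime] {ι : Type*} (s : Finset ι) (m : ι → ℕ)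
    (h : (p.digits (∑ i ∈ s, m i)).sum + f * (p - 1) ≤ ∑ i ∈ s, (p.digits (m i)).sum) :
    p ^ f ∣ Nat.multinomial s m := by
  have hspec := congrArg (padicValNat p) (Nat.multinomial_spec s m)
  have h0 : Nat.multinomial s m ≠ 0 := (Nat.multinomial_pos s m).ne'
  have hprod : padicValNat p (∏ i ∈ s, (m i).factorial) = ∑ i ∈ s, padicValNat p (m i).factorial := by
    simp only [← Nat.factorization_def _ hp.out]
    exact Nat.factorization_prod_apply fun i _ => Nat.factorial_ne_zero _
  rw [padicValNat.mul (Finset.prod_ne_zero_iff.2 fun i _ => Nat.factorial_ne_zero _) h0,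
    hprod] at hspec
  have hleg (n : ℕ) : (p - 1) * padicValNat p n.factorial + (p.digits n).sum = n := by
    rw [sub_one_mul_padicValNat_factorial, Nat.sub_add_cancel (Nat.digit_sum_le p n)]
  have hs : (p - 1) * ∑ i ∈ s, padicValNat p (m i).factorial + ∑ i ∈ s, (p.digits (m i)).sum
      = ∑ i ∈ s, m i := by
    rw [Finset.mul_sum, ← Finset.sum_add_distrib]
    exact Finset.sum_congr rfl fun i _ => hleg _
  have ht := hleg (∑ i ∈ s, m i)
  rw [← hspec, mul_add] at ht
  rw [padicValNat_dvd_iff_le h0]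
  have hp1 := hp.out.one_lt
  refine Nat.le_of_mul_le_mul_left ?_ (show 0 < p - 1 by lia)
  lia

namespace WittVector

variable {p : ℕ} [hp : Fact p.Prime] {k : Type*} [Field k] [CharP k p]

theorem natCast_dvd_iff_constantCoeff_eq_zero [PerfectRing k p] (a : WittVector p k) :
    (p : WittVector p k) ∣ a ↔ constantCoeff a = 0 := by
  rw [← Ideal.mem_span_singleton, mem_span_p_iff_coeff_zero_eq_zero]
  rfl

theorem pow_dvd_of_natCast_pow_dvd_natCast {f N : ℕ}
    (h : (p : WittVector p k) ^ f ∣ (N : WittVector p k)) : p ^ f ∣ N := by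
  induction f generalizing N with
  | zero => simp
  | succ f ih =>
    have h1 : p ∣ N := by
      obtain ⟨c, hc⟩ := (dvd_pow_self (p : WittVector p k) f.succ_ne_zero).trans h
      rw [← CharP.cast_eq_zero_iff k p]
      simpa only [map_natCast, map_mul, CharP.cast_eq_zero, zero_mul] using
        congrArg constantCoeff hc
    obtain ⟨N, rfl⟩ := h1
    rw [pow_succ', Nat.cast_mul] at h
    rw [pow_succ']
    exact mul_dvd_mul_left p (ih ((mul_dvd_mul_iff_left (p_nonzero p k)).1 h))

theorem sum_teichmuller_pow_eq_zero [Fintype k] {e : ℕ} (he : ¬ Fintype.card k - 1 ∣ e) :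
    ∑ a : k, teichmuller p a ^ e = 0 := by
  rw [← FiniteField.forall_pow_eq_one_iff k] at he
  push Not at he
  obtain ⟨g, hg⟩ := he
  have h : teichmuller p (g : k) ^ e * ∑ a : k, teichmuller p a ^ e
      = ∑ a : k, teichmuller p a ^ e := by
    rw [Finset.mul_sum]
    exact Fintype.sum_equiv (Units.mulLeft g) _ _ fun a => by simp [mul_pow]
  rw [← sub_eq_zero, ← sub_one_mul] at h
  refine (mul_eq_zero.1 h).resolve_left fun h0 => hg ?_
  ext
  have := congrArg constantCoeff (sub_eq_zero.1 h0)
  rw [map_pow, map_one] at this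
  simpa using this

/-- Modulo `p ^ f`, raising to the power `p ^ f * (p ^ f - 1)` detects whether the residue in a field
of cardinality `p ^ f` vanishes. -/
theorem natCast_pow_dvd_one_sub_pow_sub_ite [Fintype k] [DecidableEq k] {f : ℕ}
    (hcard : Fintype.card k = p ^ f) (a : WittVector p k) :
    (p : WittVector p k) ^ f ∣
      1 - a ^ (p ^ f * (p ^ f - 1)) - if constantCoeff a = 0 then 1 else 0 := by
  have hq1 : 1 < p ^ f := hcard ▸ Fintype.one_lt_card
  split_ifs with ha
  · rw [← natCast_dvd_iff_constantCoeff_eq_zero] at ha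
    have hM : f ≤ p ^ f * (p ^ f - 1) :=
      (Nat.lt_pow_self hp.out.one_lt).le.trans (Nat.le_mul_of_pos_right _ (by lia))
    rw [sub_sub_cancel_left, dvd_neg]
    exact (pow_dvd_pow_of_dvd ha f).trans (pow_dvd_pow _ hM)
  · have h1 : (p : WittVector p k) ∣ 1 - a ^ (p ^ f - 1) := by
      rw [natCast_dvd_iff_constantCoeff_eq_zero, map_sub, map_pow, map_one,
        ← hcard, FiniteField.pow_card_sub_one_eq_one _ ha, sub_self]
    have h2 := dvd_sub_pow_of_dvd_sub h1 f
    rw [one_pow, ← pow_mul, mul_comm] at h2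
    rw [sub_zero]
    exact (pow_dvd_pow _ f.le_succ).trans h2

/-- Power sums of a polynomial of low degree over all tuples of Teichmüller representatives. -/
theorem natCast_pow_dvd_sum_teichmuller [Fintype k] {f : ℕ} (hcard : Fintype.card k = p ^ f)
    {σ : Type*} [Fintype σ] [DecidableEq σ] [Nonempty σ] (S : Finset (σ →₀ ℕ))
    (hS : ∀ e ∈ S, ∑ j, e j < Fintype.card σ) (c : (σ →₀ ℕ) → WittVector p k) {M : ℕ}
    (hM : p ^ f - 1 ∣ M) (hdig : (p.digits M).sum = f * (p - 1)) :
    (p : WittVector p k) ^ f ∣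
      ∑ x : σ → k, (∑ e ∈ S, c e * ∏ j, teichmuller p (x j) ^ e j) ^ M := by
  have hp1 := hp.out.one_lt
  have hf : f ≠ 0 := by
    rintro rfl
    exact (Fintype.one_lt_card (α := k)).ne' hcard
  have hexp (x : σ → k) : (∑ e ∈ S, c e * ∏ j, teichmuller p (x j) ^ e j) ^ M =
      ∑ m ∈ S.piAntidiag M, Nat.multinomial S m * ((∏ e ∈ S, c e ^ m e) *
        ∏ j, teichmuller p (x j) ^ ∑ e ∈ S, m e * e j) := by
    rw [Finset.sum_pow_eq_sum_piAntidiag]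
    refine Finset.sum_congr rfl fun m _ => ?_
    simp only [mul_pow, Finset.prod_mul_distrib, ← Finset.prod_pow, ← Finset.prod_pow_eq_pow_sum,
      ← pow_mul]
    rw [Finset.prod_comm]
    simp only [mul_comm]
  simp only [hexp]
  rw [Finset.sum_comm]
  refine Finset.dvd_sum fun m hm => ?_
  rw [Finset.mem_piAntidiag] at hm
  rw [← Finset.mul_sum, ← Finset.mul_sum,
    ← Fintype.prod_sum fun j a => teichmuller p a ^ ∑ e ∈ S, m e * e j]
  by_cases hE : ∀ j, p ^ f - 1 ∣ ∑ e ∈ S, m e * e j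
  · by_cases hE0 : ∀ j, ∑ e ∈ S, m e * e j ≠ 0
    · refine Dvd.dvd.mul_right ?_ _
      rw [← Nat.cast_pow]
      refine Nat.cast_dvd_cast (pow_dvd_multinomial _ _ ?_)
      rw [hm.1, hdig, ← two_mul]
      exact two_mul_le_sum_digits_sum hp1 hf S m (fun e j => e j) hS (hm.1 ▸ hM) hE hE0
    · push Not at hE0
      obtain ⟨j, hj⟩ := hE0
      refine ((dvd_trans ?_ (Finset.dvd_prod_of_mem _ (Finset.mem_univ j))).mul_left _).mul_left _
      simp only [hj, pow_zero, Finset.sum_const, Finset.card_univ, hcard, nsmul_eq_mul, mul_one,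
        Nat.cast_pow, dvd_refl]
  · push Not at hE
    obtain ⟨j, hj⟩ := hE
    rw [Finset.prod_eq_zero (Finset.mem_univ j) (sum_teichmuller_pow_eq_zero (by rwa [hcard])),
      mul_zero, mul_zero]
    exact dvd_zero _

end WittVector

open MvPolynomial

/-- The number of zeros in affine space of a polynomial of degree less than the number of variables
is divisible by the cardinality of the finite base field. -/
theorem card_dvd_card_zeros {k σ : Type*} [Field k] [Fintype k] [DecidableEq k] [Fintype σ]
    [DecidableEq σ] (F : MvPolynomial σ k) (hF : F.totalDegree < Fintype.card σ) :
    Fintype.card k ∣ Fintype.card {x : σ → k // eval x F = 0} := by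
  obtain ⟨p, hchar⟩ := CharP.exists k
  obtain ⟨⟨f, hf⟩, hpp, hcard⟩ := FiniteField.card k p
  rw [PNat.mk_coe] at hcard
  have : Fact p.Prime := ⟨hpp⟩
  have hp1 := hpp.one_lt
  have : Nonempty σ := Fintype.card_pos_iff.1 (by lia)
  have hq1 : 1 < p ^ f := Nat.one_lt_pow hf.ne' hp1
  have hdig : (p.digits (p ^ f * (p ^ f - 1))).sum = f * (p - 1) := by
    rw [Nat.digits_base_pow_mul hp1 (by lia), List.sum_append, sum_digits_pow_sub_one hp1]
    simp
  have hpow := WittVector.natCast_pow_dvd_sum_teichmuller hcard F.support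
    (fun e he => lt_of_le_of_lt (Finsupp.degree_eq_sum e ▸ le_totalDegree he) hF)
    (fun e => WittVector.teichmuller p (F.coeff e)) (dvd_mul_left _ _) hdig
  have hind (x : σ → k) := WittVector.natCast_pow_dvd_one_sub_pow_sub_ite hcard
    (∑ e ∈ F.support, WittVector.teichmuller p (F.coeff e) *
      ∏ j, WittVector.teichmuller p (x j) ^ e j)
  have hG (x : σ → k) : WittVector.constantCoeff (∑ e ∈ F.support,
      WittVector.teichmuller p (F.coeff e) * ∏ j, WittVector.teichmuller p (x j) ^ e j) =
        eval x F := by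
    rw [eval_eq']
    simp only [map_sum, map_mul, map_prod, map_pow]
    rfl
  simp only [hG] at hind
  rw [hcard]
  apply WittVector.pow_dvd_of_natCast_pow_dvd_natCast (k := k)
  rw [Fintype.card_subtype, ← Finset.sum_boole]
  have hall : (p : WittVector p k) ^ f ∣ ∑ _x : σ → k, 1 := by
    simp only [Finset.sum_const, Finset.card_univ, Fintype.card_fun, hcard, nsmul_eq_mul, mul_one,
      Nat.cast_pow]
    exact dvd_pow_self _ Fintype.card_ne_zero
  have hsum := Finset.dvd_sum fun x (_ : x ∈ Finset.univ) => hind x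
  rw [Finset.sum_sub_distrib, Finset.sum_sub_distrib] at hsum
  exact (dvd_sub_right (dvd_sub hall hpow)).1 hsum

/-- The number of common zeros in affine space of finitely many polynomials whose degrees add up
to less than the number of variables is divisible by the cardinality of the finite base field. -/
theorem card_dvd_card_common_zeros {k σ ι : Type*} [Field k] [Fintype k] [DecidableEq k]
    [Fintype σ] [DecidableEq σ] [Fintype ι] [DecidableEq ι] (F : ι → MvPolynomial σ k)
    (hF : ∑ i, (F i).totalDegree < Fintype.card σ) :
    Fintype.card k ∣ Fintype.card {x : σ → k // ∀ i, eval x (F i) = 0} := by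
  have : Nonempty σ := Fintype.card_pos_iff.1 (by lia)
  have hne (S : Finset ι) : (Fintype.card k : ℤ) ∣
      ∑ x : σ → k, if ∏ i ∈ S, eval x (F i) = 0 then 0 else 1 := by
    have h1 := card_dvd_card_zeros (∏ i ∈ S, F i) <| lt_of_le_of_lt
      ((totalDegree_finsetProd S F).trans (Finset.sum_le_univ_sum_of_nonneg fun _ => zero_le)) hF
    have h2 : ∑ x : σ → k, (if ∏ i ∈ S, eval x (F i) = 0 then 0 else 1 : ℤ) =
        (Fintype.card k : ℤ) ^ Fintype.card σ -
          Fintype.card {x : σ → k // eval x (∏ i ∈ S, F i) = 0} := by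
      rw [Fintype.card_subtype, ← Finset.sum_boole, eq_sub_iff_add_eq, ← Finset.sum_add_distrib]
      simp only [map_prod]
      rw [Finset.sum_congr rfl (g := fun _ => 1) fun x _ => by split_ifs <;> simp]
      simp
    rw [h2]
    exact dvd_sub (dvd_pow_self _ Fintype.card_ne_zero) (Int.natCast_dvd_natCast.2 h1)
  have hprod (x : σ → k) : (if ∀ i, eval x (F i) = 0 then 1 else 0 : ℤ) =
      ∑ S : Finset ι, (-1) ^ S.card * if ∏ i ∈ S, eval x (F i) = 0 then 0 else 1 := by
    have h := Fintype.prod_add (fun i => -(if eval x (F i) = 0 then 0 else 1 : ℤ)) fun _ => 1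
    simp only [Finset.prod_neg, Finset.prod_const_one, mul_one] at h
    convert h using 1
    · split_ifs with hx
      · simp [hx]
      · push Not at hx
        obtain ⟨i, hi⟩ := hx
        exact (Finset.prod_eq_zero (Finset.mem_univ i) (by simp [hi])).symm
    · refine Finset.sum_congr rfl fun S _ => congrArg _ ?_
      split_ifs with hx
      · obtain ⟨i, hi, hi0⟩ := Finset.prod_eq_zero_iff.1 hx
        exact (Finset.prod_eq_zero (i := i) hi (by simp [hi0])).symm
      · exact (Finset.prod_eq_one fun i hi => if_neg (Finset.prod_ne_zero_iff.1 hx i hi)).symm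
  rw [← Int.natCast_dvd_natCast, Fintype.card_subtype, ← Finset.sum_boole]
  simp only [hprod]
  rw [Finset.sum_comm]
  refine Finset.dvd_sum fun S _ => ?_
  rw [← Finset.mul_sum]
  exact (hne S).mul_left _

theorem MvPolynomial.IsHomogeneous.eval_smul_eq_pow_mul {k σ : Type*} [CommSemiring k] [Fintype σ]
    {F : MvPolynomial σ k} {d : ℕ} (hF : F.IsHomogeneous d) (c : k) (x : σ → k) :
    eval (c • x) F = c ^ d * eval x F := by
  rw [eval_eq', eval_eq', Finset.mul_sum]
  refine Finset.sum_congr rfl fun e he => ?_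
  have hdeg : ∑ i, e i = d := by
    rw [← Finsupp.degree_eq_sum, ← hF (mem_support_iff.1 he), Finsupp.degree_eq_weight_one]
    rfl
  simp only [Pi.smul_apply, smul_eq_mul, mul_pow, Finset.prod_mul_distrib,
    Finset.prod_pow_eq_pow_sum, hdeg]
  ring

/-- The affine cone over a projective variety consists of the origin and `q - 1` points on every
line of the variety. -/
theorem card_common_zeros_eq_card_projective {k σ ι : Type*} [Field k] [Fintype k]
    [Fintype σ] (F : ι → MvPolynomial σ k) (d : ι → ℕ)
    (hF : ∀ i, (F i).IsHomogeneous (d i)) (hd : ∀ i, d i ≠ 0) :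
    Nat.card {x : σ → k // ∀ i, eval x (F i) = 0} =
      Nat.card {P : Projectivization k (σ → k) // ∃ (v : σ → k) (hv : v ≠ 0),
        P = Projectivization.mk k v hv ∧ ∀ i, eval v (F i) = 0} * (Fintype.card k - 1) + 1 := by
  classical
  set X := {P : Projectivization k (σ → k) // ∃ (v : σ → k) (hv : v ≠ 0),
    P = Projectivization.mk k v hv ∧ ∀ i, eval v (F i) = 0}
  have hsmul {x : σ → k} (hx : ∀ i, eval x (F i) = 0) (c : k) (i : ι) : eval (c • x) (F i) = 0 := by
    rw [(hF i).eval_smul_eq_pow_mul, hx, mul_zero]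
  have hrep (P : X) (i : ι) : eval P.1.rep (F i) = 0 := by
    obtain ⟨_, v, hv, rfl, h⟩ := P
    obtain ⟨a, ha⟩ := Projectivization.exists_smul_eq_mk_rep k v hv
    simpa only [← ha, Units.smul_def] using hsmul h a i
  have hzero (i : ι) : eval (0 : σ → k) (F i) = 0 := by
    simpa [hd i] using (hF i).eval_smul_eq_pow_mul 0 (0 : σ → k)
  let g : Option (X × kˣ) → {x : σ → k // ∀ i, eval x (F i) = 0}
    | none => ⟨0, hzero⟩
    | some (P, u) => ⟨(u : k) • P.1.rep, hsmul (hrep P) u⟩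
  have hne (P : X) (u : kˣ) : (u : k) • P.1.rep ≠ 0 :=
    smul_ne_zero u.ne_zero P.1.rep_nonzero
  have hmk (P : X) (u : kˣ) : Projectivization.mk k _ (hne P u) = P.1 := by
    conv_rhs => rw [← P.1.mk_rep]
    exact (Projectivization.mk_eq_mk_iff _ _ _ _ _).2 ⟨u, rfl⟩
  have hg : Function.Bijective g := by
    constructor
    · rintro (_ | ⟨P, u⟩) (_ | ⟨P', u'⟩) h
      · rfl
      · exact (hne P' u' (congrArg Subtype.val h).symm).elim
      · exact (hne P u (congrArg Subtype.val h)).elim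
      · have h : (u : k) • P.1.rep = (u' : k) • P'.1.rep := congrArg Subtype.val h
        obtain rfl : P = P' := Subtype.ext <| by
          rw [← hmk P u, ← hmk P' u']
          simp only [h]
        rw [Units.ext (smul_left_injective k P.1.rep_nonzero h)]
    · rintro ⟨x, hx⟩
      by_cases h0 : x = 0
      · exact ⟨none, Subtype.ext h0.symm⟩
      · obtain ⟨a, ha⟩ := Projectivization.exists_smul_eq_mk_rep k x h0
        refine ⟨some (⟨Projectivization.mk k x h0, x, h0, rfl, hx⟩, a⁻¹), Subtype.ext ?_⟩
        change ((a⁻¹ : kˣ) : k) • (Projectivization.mk k x h0).rep = x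
        rw [← ha, ← Units.smul_def, inv_smul_smul]
  rw [← Nat.card_eq_of_bijective g hg, Finite.card_option, Nat.card_prod,
    Nat.card_eq_fintype_card (α := kˣ), Fintype.card_units]


/-- **Ax's theorem for intersections of hypersurfaces of low degree**. Over a finite field
`k` of cardinality `q`, if `f 1, …, f r` are homogeneous polynomials in `n+1` variables of
degrees `d 1, …, d r` with `∑ d j ≤ n`, then the number of `k`-points of the projective
variety `{f 1 = ⋯ = f r = 0} ⊂ ℙⁿ` is congruent to `1` modulo `q`. The `k`-points are the
classes, modulo scalar multiplication, of nonzero common zeros. -/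
theorem ax_projective_intersection
    (q : ℕ) (k : Type) [Field k] [Fintype k] (hq : Fintype.card k = q)
    (n r : ℕ) (hr : 1 ≤ r) (d : Fin r → ℕ) (hd : ∀ j, 1 ≤ d j)
    (hdn : (∑ j, d j) ≤ n)
    (f : Fin r → MvPolynomial (Fin (n + 1)) k)
    (hf : ∀ j, (f j).IsHomogeneous (d j)) :
    Nat.card {P : Projectivization k (Fin (n + 1) → k) //
        ∃ (v : Fin (n + 1) → k) (hv : v ≠ 0),
          P = Projectivization.mk k v hv ∧ ∀ j, MvPolynomial.eval v (f j) = 0}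
      ≡ 1 [MOD q] := by
  classical
  have hN := card_dvd_card_common_zeros f <| lt_of_le_of_lt
    (Finset.sum_le_sum fun j _ => (hf j).totalDegree_le) (by simpa using Nat.lt_succ_of_le hdn)
  rw [hq, Fintype.card_eq_nat_card,
    card_common_zeros_eq_card_projective f d hf fun j => Nat.ne_of_gt (hd j), hq] at hN
  have hq0 : 1 ≤ q := hq ▸ Fintype.card_pos
  generalize Nat.card _ = N at hN ⊢
  rw [Nat.modEq_iff_dvd, Nat.cast_one]
  have h : (q : ℤ) ∣ (N * (q - 1 : ℕ) + 1 : ℕ) := Int.natCast_dvd_natCast.2 hN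
  push_cast [hq0] at h
  have h2 : (1 - N : ℤ) = (N * (q - 1) + 1) - q * N := by ring
  rw [h2]
  exact dvd_sub h (dvd_mul_right _ _)
end

section
/- Let k be a field and i a natural number. If k is a C_i field, then the field k((t)) of formal Laurent series in one variable with coefficients in k is a C_{i+1} field. -/
/-- A field `K` is `C_i` if every homogeneous polynomial of degree `m ≥ 1` in `n+1`
variables with `m ^ i ≤ n` has a nontrivial zero over `K`. -/
def IsCField (i : ℕ) (K : Type*) [Field K] : Prop :=
  ∀ (n m : ℕ), 1 ≤ m → m ^ i ≤ n →
    ∀ f : MvPolynomial (Fin (n + 1)) K, f.IsHomogeneous m →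
      ∃ x : Fin (n + 1) → K, x ≠ 0 ∧ MvPolynomial.eval x f = 0

/-! ### Systems of forms over a `C_i` field -/

section Systems

open MvPolynomial

/-- Over an algebraically closed field, fewer equations than unknowns without constant terms have
a nontrivial common zero. -/
theorem exists_common_zero_of_isAlgClosed {k ι σ : Type*} [Field k] [IsAlgClosed k] [Finite ι]
    [Finite σ] (f : ι → MvPolynomial σ k) (hf : ∀ j, eval 0 (f j) = 0)
    (hcard : Nat.card ι < Nat.card σ) : ∃ x : σ → k, x ≠ 0 ∧ ∀ j, eval x (f j) = 0 := by
  by_contra! H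
  have hdim : ringKrullDim (MvPolynomial σ k) ≤ (Nat.card ι : ℕ∞) := by
    rw [ringKrullDim_le_iff_isMaximal_height_le]
    intro m hm
    obtain ⟨a, rfl⟩ := isMaximal_iff_eq_vanishingIdeal_singleton.1 hm
    let g : ι → MvPolynomial σ k := fun j => aeval (fun s => X s - C (a s)) (f j)
    have hg : ∀ x j, eval x (g j) = eval (x - a) (f j) := by
      intro x j
      have : (aeval x).comp (aeval fun s => X s - C (a s)) = aeval (R := k) (x - a) := by
        ext s; simp
      simpa [g, aeval_eq_eval] using DFunLike.congr_fun this (f j)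
    have hzero : zeroLocus k (Ideal.span (Set.range g)) = {a} := by
      rw [zeroLocus_span]
      ext x
      simp only [Set.forall_mem_range, aeval_eq_eval, Set.mem_ofPred_eq,
        Set.mem_singleton_iff, hg]
      constructor
      · intro hx
        by_contra hne
        obtain ⟨j, hj⟩ := H (x - a) (sub_ne_zero.2 hne)
        exact hj (hx j)
      · rintro rfl j
        simpa using hf j
    have hmem : vanishingIdeal k {a} ∈ (Ideal.span (Set.range g)).minimalPrimes := by
      rw [← Ideal.radical_minimalPrimes, ← vanishingIdeal_zeroLocus_eq_radical (K := k), hzero,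
        Ideal.minimalPrimes_eq_subsingleton_self]
      rfl
    have := Ideal.height_le_card_of_mem_minimalPrimes_span (Set.finite_range g) hmem
    refine WithBot.coe_le_coe.2 (this.trans ?_)
    have h2 : (Set.range g).ncard ≤ Nat.card ι := by
      rw [← Nat.card_coe_set_eq]; exact Finite.card_range_le g
    exact_mod_cast h2
  rw [MvPolynomial.ringKrullDim_of_isNoetherianRing, ringKrullDim_eq_zero_of_field,
    zero_add] at hdim
  have h3 : Nat.card σ ≤ Nat.card ι := by exact_mod_cast hdim
  omega

/-- There is a form of degree `D ≥ 1` in `m` variables having only the trivial zero. -/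
def HasAnisotropicForm (k : Type*) [Field k] (D m : ℕ) : Prop :=
  1 ≤ D ∧ ∃ N : MvPolynomial (Fin m) k, N.IsHomogeneous D ∧ ∀ x, eval x N = 0 → x = 0

variable {k : Type*} [Field k]

theorem IsCField.le_pow {i : ℕ} (hk : IsCField i k) {D m : ℕ} (h : HasAnisotropicForm k D m) :
    m ≤ D ^ i := by
  obtain ⟨hD, N, hN, hx⟩ := h
  by_contra! hlt
  obtain ⟨n, rfl⟩ : ∃ n, m = n + 1 := ⟨m - 1, by omega⟩
  obtain ⟨x, hx0, h0⟩ := hk n D hD (by omega) N hN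
  exact hx0 (hx x h0)

theorem HasAnisotropicForm.mono {D m m' : ℕ} (h : HasAnisotropicForm k D m) (hm : m' ≤ m) :
    HasAnisotropicForm k D m' := by
  obtain ⟨hD, N, hN, hx⟩ := h
  let s : Fin m → MvPolynomial (Fin m') k := fun c => if h : c.1 < m' then X ⟨c, h⟩ else 0
  refine ⟨hD, aeval s N, ?_, fun y hy => ?_⟩
  · simpa using hN.aeval s (n := 1) fun c => by
      by_cases h : c.1 < m'
      · simpa [s, h] using isHomogeneous_X _ _
      · simpa [s, h] using isHomogeneous_zero _ _ _
  · have hc : (eval y (aeval s N)) = eval (fun c => eval y (s c)) N := by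
      have : (aeval y).comp (aeval s) = aeval (R := k) (fun c => eval y (s c)) := by
        ext s; simp [aeval_eq_eval]
      simpa [aeval_eq_eval] using DFunLike.congr_fun this N
    have h0 := hx _ (hc ▸ hy)
    ext b
    simpa [s] using congr_fun h0 (Fin.castLE hm b)

/-- Substituting disjoint copies of an anisotropic system of forms in an anisotropic form. -/
theorem HasAnisotropicForm.comp {D m d n r : ℕ} (h : HasAnisotropicForm k D m) (hd : 1 ≤ d)
    (f : Fin r → MvPolynomial (Fin n) k) (hf : ∀ j, (f j).IsHomogeneous d)
    (hzero : ∀ x, (∀ j, eval x (f j) = 0) → x = 0) :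
    HasAnisotropicForm k (d * D) (m / r * n) := by
  obtain ⟨hD, N, hN, hx⟩ := h.mono (Nat.div_mul_le_self m r)
  let s : Fin (m / r * r) → MvPolynomial (Fin (m / r * n)) k := fun c =>
    rename (fun b => finProdFinEquiv ((finProdFinEquiv.symm c).1, b)) (f (finProdFinEquiv.symm c).2)
  refine ⟨Nat.mul_pos hd hD, aeval s N, hN.aeval s fun c => (hf _).rename_isHomogeneous,
    fun y hy => ?_⟩
  have hc : (eval y (aeval s N)) = eval (fun c => eval y (s c)) N := by
    have : (aeval y).comp (aeval s) = aeval (R := k) (fun c => eval y (s c)) := by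
      ext s; simp [aeval_eq_eval]
    simpa [aeval_eq_eval] using DFunLike.congr_fun this N
  have h0 := hx _ (hc ▸ hy)
  have hblock : ∀ a : Fin (m / r), (fun b => y (finProdFinEquiv (a, b))) = 0 := fun a =>
    hzero _ fun j => by
      have h1 := congr_fun h0 (finProdFinEquiv (a, j))
      simp only [s, Equiv.symm_apply_apply, eval_rename] at h1
      exact h1
  ext c
  have h1 := congr_fun (hblock (finProdFinEquiv.symm c).1) (finProdFinEquiv.symm c).2
  simpa only [Prod.mk.eta, Equiv.apply_symm_apply, Pi.zero_apply] using h1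

theorem exists_binary_anisotropicForm (hk : ¬ IsAlgClosed k) :
    ∃ e, HasAnisotropicForm k e 2 := by
  obtain ⟨p, hmon, hirr, hroot⟩ : ∃ p : Polynomial k, p.Monic ∧ Irreducible p ∧
      ∀ x, p.eval x ≠ 0 := by
    by_contra! H
    exact hk (IsAlgClosed.of_exists_root _ fun p hm hi => H p hm hi)
  let e := p.natDegree
  have he : 1 ≤ e := hirr.natDegree_pos
  let N : MvPolynomial (Fin 2) k :=
    ∑ j ∈ Finset.range (e + 1), C (p.coeff j) * (X 0 ^ j * X 1 ^ (e - j))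
  refine ⟨e, he, N, ?_, fun x hx => ?_⟩
  · refine IsHomogeneous.sum _ _ _ fun j hj => ?_
    have hje : j + (e - j) = e := by have := Finset.mem_range.1 hj; omega
    have := (isHomogeneous_X_pow (R := k) (0 : Fin 2) j).mul (isHomogeneous_X_pow 1 (e - j))
    rw [hje] at this
    exact this.C_mul _
  · have hN : ∑ j ∈ Finset.range (e + 1), p.coeff j * (x 0 ^ j * x 1 ^ (e - j)) = 0 := by
      simpa [N] using hx
    by_cases h1 : x 1 = 0
    · rw [Finset.sum_range_succ, Finset.sum_eq_zero fun j hj => ?_] at hN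
      · have h0 : x 0 = 0 := by
          have hc : p.coeff e = 1 := hmon
          simpa [hc, (show e ≠ 0 by omega)] using hN
        ext j
        fin_cases j <;> simp [h0, h1]
      · have := Finset.mem_range.1 hj
        simp [h1, (show e - j ≠ 0 by omega)]
    · exfalso
      refine hroot (x 0 / x 1) ?_
      rw [Polynomial.eval_eq_sum_range]
      have h2 : (x 1) ^ e * ∑ j ∈ Finset.range (e + 1), p.coeff j * (x 0 / x 1) ^ j = 0 := by
        rw [← hN, Finset.mul_sum]
        refine Finset.sum_congr rfl fun j hj => ?_
        have hje : x 1 ^ e = x 1 ^ j * x 1 ^ (e - j) := by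
          rw [← pow_add]; congr 1; have := Finset.mem_range.1 hj; omega
        rw [hje, div_pow]
        field_simp
      exact (mul_eq_zero.1 h2).resolve_left (pow_ne_zero _ h1)

theorem exists_anisotropicForm_of_not_isAlgClosed (hk : ¬ IsAlgClosed k) (s : ℕ) :
    ∃ D, HasAnisotropicForm k D (2 ^ s) := by
  obtain ⟨e, he, N, hN, hx⟩ := exists_binary_anisotropicForm hk
  induction s with
  | zero =>
    refine ⟨1, ?_⟩
    rw [pow_zero]
    refine ⟨le_rfl, X 0, isHomogeneous_X _ _, fun x h => ?_⟩
    ext j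
    rw [Subsingleton.elim j 0]
    simpa using h
  | succ s ih =>
    obtain ⟨D, hD⟩ := ih
    refine ⟨e * D, ?_⟩
    simpa [pow_succ] using hD.comp (r := 1) he (fun _ => N) (fun _ => hN) fun x h => hx x (h 0)

/-- **Lang–Nagata theorem** for systems of forms of equal degree. -/
theorem IsCField.exists_common_zero {i : ℕ} (hk : IsCField i k) {d n r : ℕ} (hd : 1 ≤ d)
    (hr : 1 ≤ r) (hn : r * d ^ i < n) (f : Fin r → MvPolynomial (Fin n) k)
    (hf : ∀ j, (f j).IsHomogeneous d) : ∃ x : Fin n → k, x ≠ 0 ∧ ∀ j, eval x (f j) = 0 := by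
  have hrn : r < n := lt_of_le_of_lt (Nat.le_mul_of_pos_right r (pow_pos hd i)) hn
  by_cases hk' : IsAlgClosed k
  · refine exists_common_zero_of_isAlgClosed f (fun j => ?_) (by simpa using hrn)
    have := (hf j).coeff_eq_zero (d := 0) (by simp; omega)
    simpa [← constantCoeff_eq, eval_zero] using this
  by_contra! H
  have hzero : ∀ x, (∀ j, eval x (f j) = 0) → x = 0 := fun x hx => by
    by_contra hx0
    obtain ⟨j, hj⟩ := H x hx0
    exact hj (hx j)
  set s := n * (r - 1) with hs
  obtain ⟨D, hD⟩ := exists_anisotropicForm_of_not_isAlgClosed hk' (s + 1)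
  have hiter : ∀ j, ∃ m, HasAnisotropicForm k (d ^ j * D) m ∧ n ^ j + s * r ^ j ≤ m * r ^ j := by
    intro j
    induction j with
    | zero =>
      refine ⟨_, by simpa using hD, ?_⟩
      have := Nat.lt_two_pow_self (n := s + 1)
      simp; omega
    | succ j ih =>
      obtain ⟨m, hm, hle⟩ := ih
      refine ⟨_, by simpa [pow_succ, mul_comm, mul_assoc, mul_left_comm] using hm.comp hd f hf hzero, ?_⟩
      have hdiv : m + 1 ≤ (m / r) * r + r := by
        have := Nat.div_add_mod' m r
        have := Nat.mod_lt m (show 0 < r by omega)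
        omega
      have hss : s * r + n * (r - 1) ≤ n * s := by
        have h1 : r + 1 ≤ n := hrn
        calc s * r + n * (r - 1) = s * (r + 1) := by rw [← hs]; ring
          _ ≤ s * n := Nat.mul_le_mul_left _ h1
          _ = n * s := mul_comm _ _
      obtain ⟨r', rfl⟩ : ∃ r', r = r' + 1 := ⟨r - 1, by omega⟩
      simp only [Nat.add_sub_cancel] at hss hs
      have h1 : m ≤ (m / (r' + 1)) * (r' + 1) + r' := by omega
      have h2 := Nat.mul_le_mul_left (n * (r' + 1) ^ j) h1
      have h3 := Nat.mul_le_mul_left n hle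
      have h4 := Nat.mul_le_mul_left ((r' + 1) ^ j) hss
      rw [pow_succ, pow_succ]
      nlinarith
  have hbound : ∀ j, n ^ j ≤ (r * d ^ i) ^ j * D ^ i := by
    intro j
    obtain ⟨m, hm, hle⟩ := hiter j
    have h1 := hk.le_pow hm
    calc n ^ j ≤ m * r ^ j := by omega
      _ ≤ (d ^ j * D) ^ i * r ^ j := Nat.mul_le_mul_right _ h1
      _ = (r * d ^ i) ^ j * D ^ i := by rw [mul_pow, mul_pow, ← pow_mul, ← pow_mul]; ring
  have hpos : 0 < r * d ^ i := Nat.mul_pos hr (pow_pos hd i)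
  obtain ⟨j, hj⟩ := pow_unbounded_of_one_lt ((D : ℝ) ^ i)
    (show (1 : ℝ) < n / (r * d ^ i : ℕ) by
      rw [one_lt_div (by exact_mod_cast hpos)]; exact_mod_cast hn)
  rw [div_pow, lt_div_iff₀ (by positivity)] at hj
  have h2 : ((n : ℝ)) ^ j ≤ ((r * d ^ i : ℕ) : ℝ) ^ j * (D : ℝ) ^ i := by exact_mod_cast hbound j
  linarith

end Systems

/-! ### Approximate zeros of forms over power series -/

section Approximation

theorem MvPolynomial.IsHomogeneous.aeval_mul {R S σ : Type*} [CommSemiring R] [CommSemiring S]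
    [Algebra R S] [Fintype σ] {f : MvPolynomial σ R} {d : ℕ} (hf : f.IsHomogeneous d) (c : S)
    (x : σ → S) :
    MvPolynomial.aeval (fun j => c * x j) f = c ^ d * MvPolynomial.aeval x f := by
  rw [aeval_def, aeval_def, eval₂_eq', eval₂_eq', Finset.mul_sum]
  refine Finset.sum_congr rfl fun m hm => ?_
  have hdeg : ∑ j, m j = d := by
    rw [← Finsupp.degree_eq_sum, hf.degree_eq_sum_deg_support hm, Finsupp.degree_apply]
  simp_rw [mul_pow, Finset.prod_mul_distrib, Finset.prod_pow_eq_pow_sum, hdeg]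
  ring

open PowerSeries

variable {k σ : Type*} [Field k]

/-- Every coefficient of the power series is a form of degree `a`. -/
def HasHomogeneousCoeffs (a : ℕ) (p : PowerSeries (MvPolynomial σ k)) : Prop :=
  ∀ l, (coeff l p).IsHomogeneous a

theorem HasHomogeneousCoeffs.mul {a b : ℕ} {p q : PowerSeries (MvPolynomial σ k)}
    (hp : HasHomogeneousCoeffs a p) (hq : HasHomogeneousCoeffs b q) :
    HasHomogeneousCoeffs (a + b) (p * q) := fun l => by
  rw [coeff_mul]
  exact MvPolynomial.IsHomogeneous.sum _ _ _ fun c _ => (hp _).mul (hq _)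

theorem HasHomogeneousCoeffs.sum {ι : Type*} {a : ℕ} (s : Finset ι)
    (p : ι → PowerSeries (MvPolynomial σ k)) (hp : ∀ j ∈ s, HasHomogeneousCoeffs a (p j)) :
    HasHomogeneousCoeffs a (∑ j ∈ s, p j) := fun l => by
  rw [map_sum]
  exact MvPolynomial.IsHomogeneous.sum _ _ _ fun c hc => hp c hc l

theorem HasHomogeneousCoeffs.C {a : ℕ} {q : MvPolynomial σ k} (hq : q.IsHomogeneous a) :
    HasHomogeneousCoeffs a (PowerSeries.C q) := fun l => by
  rw [coeff_C]
  split_ifs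
  · exact hq
  · exact MvPolynomial.isHomogeneous_zero _ _ _

theorem HasHomogeneousCoeffs.map_C (g : PowerSeries k) :
    HasHomogeneousCoeffs 0 (PowerSeries.map (MvPolynomial.C (σ := σ)) g) := fun l => by
  rw [coeff_map]
  exact MvPolynomial.isHomogeneous_C _ _

theorem HasHomogeneousCoeffs.pow {a : ℕ} {p : PowerSeries (MvPolynomial σ k)}
    (hp : HasHomogeneousCoeffs a p) (e : ℕ) : HasHomogeneousCoeffs (a * e) (p ^ e) := by
  induction e with
  | zero => simpa using HasHomogeneousCoeffs.C (MvPolynomial.isHomogeneous_one σ k)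
  | succ e ih => exact ih.mul hp

theorem HasHomogeneousCoeffs.prod {ι : Type*} (s : Finset ι) (a : ι → ℕ)
    (p : ι → PowerSeries (MvPolynomial σ k)) (hp : ∀ j ∈ s, HasHomogeneousCoeffs (a j) (p j)) :
    HasHomogeneousCoeffs (∑ j ∈ s, a j) (∏ j ∈ s, p j) := by
  classical
  induction s using Finset.induction_on with
  | empty => simpa using HasHomogeneousCoeffs.C (MvPolynomial.isHomogeneous_one σ k)
  | insert j s hj ih =>
    rw [Finset.sum_insert hj, Finset.prod_insert hj]
    exact (hp j (Finset.mem_insert_self j s)).mul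
      (ih fun b hb => hp b (Finset.mem_insert_of_mem hb))

theorem HasHomogeneousCoeffs.eval₂ {τ : Type*} [Fintype τ] {d : ℕ}
    {f : MvPolynomial τ (PowerSeries k)} (hf : f.IsHomogeneous d)
    (x : τ → PowerSeries (MvPolynomial σ k)) (hx : ∀ j, HasHomogeneousCoeffs 1 (x j)) :
    HasHomogeneousCoeffs d (MvPolynomial.eval₂ (PowerSeries.map MvPolynomial.C) x f) := by
  rw [MvPolynomial.eval₂_eq']
  refine HasHomogeneousCoeffs.sum _ _ fun m hm => ?_
  have hdeg : 0 + ∑ j, 1 * m j = d := by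
    simp_rw [zero_add, one_mul]
    rw [← Finsupp.degree_eq_sum, hf.degree_eq_sum_deg_support hm, Finsupp.degree_apply]
  rw [← hdeg]
  exact (HasHomogeneousCoeffs.map_C _).mul
    (HasHomogeneousCoeffs.prod _ _ _ fun j _ => (hx j).pow _)

/-- A nonzero vector of power series is a power of `X` times a primitive vector. -/
theorem exists_primitive_vector {ι : Type*} (x : ι → PowerSeries k) {j₀ : ι} {l : ℕ}
    (h : coeff l (x j₀) ≠ 0) : ∃ s ≤ l, ∃ y : ι → PowerSeries k,
      (∃ j, constantCoeff (y j) ≠ 0) ∧ ∀ j, x j = X ^ s * y j := by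
  classical
  have hex : ∃ s, ¬ ∀ j, (X : PowerSeries k) ^ (s + 1) ∣ x j :=
    ⟨l, fun H => h (X_pow_dvd_iff.1 (H j₀) l l.lt_succ_self)⟩
  have hdvd : ∀ j, (X : PowerSeries k) ^ Nat.find hex ∣ x j := by
    rcases hs : Nat.find hex with - | s
    · simp
    · simpa using Nat.find_min hex (m := s) (by omega)
  choose y hy using hdvd
  refine ⟨Nat.find hex, Nat.find_min' hex fun H => h (X_pow_dvd_iff.1 (H j₀) l l.lt_succ_self),
    y, ?_, hy⟩
  by_contra! H
  refine Nat.find_spec hex fun j => ?_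
  rw [hy j, pow_succ]
  exact mul_dvd_mul_left _ (X_dvd_iff.2 (H j))

/-- Forms in more than `d ^ (i + 1)` variables over `k⟦t⟧` have primitive zeros modulo every power
of `t`. -/
theorem IsCField.exists_approximate_zero {i : ℕ} (hk : IsCField i k) {d v : ℕ} (hd : 1 ≤ d)
    (hv : d ^ (i + 1) < v) {f : MvPolynomial (Fin v) (PowerSeries k)} (hf : f.IsHomogeneous d)
    (N : ℕ) : ∃ y : Fin v → PowerSeries k, (∃ j, constantCoeff (y j) ≠ 0) ∧
      X ^ N ∣ MvPolynomial.eval y f := by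
  set M := N * d ^ i + 1 with hM
  set r := d * M + N with hr
  let x : Fin v → PowerSeries (MvPolynomial (Fin (M * v)) k) := fun j =>
    ∑ s : Fin M, PowerSeries.C (MvPolynomial.X (finProdFinEquiv (s, j))) *
      PowerSeries.map MvPolynomial.C (X ^ (s : ℕ))
  have hx : ∀ j, HasHomogeneousCoeffs 1 (x j) := fun j => HasHomogeneousCoeffs.sum _ _ fun s _ =>
    (HasHomogeneousCoeffs.C (MvPolynomial.isHomogeneous_X _ _)).mul
      (HasHomogeneousCoeffs.map_C _)
  have hF := HasHomogeneousCoeffs.eval₂ hf x hx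
  set F := MvPolynomial.eval₂ (PowerSeries.map MvPolynomial.C) x f with hFdef
  have hcard : r * d ^ i < M * v := by
    have h1 : M * (d ^ (i + 1) + 1) ≤ M * v := Nat.mul_le_mul_left _ hv
    have h2 : r * d ^ i = M * d ^ (i + 1) + N * d ^ i := by rw [hr]; ring
    rw [mul_add, mul_one] at h1
    omega
  obtain ⟨a, ha0, ha⟩ := hk.exists_common_zero hd (r := r)
    (by have := Nat.mul_pos hd (show 0 < M by omega); omega) hcard
    (fun l => coeff (l : ℕ) F) (fun l => hF l)
  let z : Fin v → PowerSeries k := fun j => PowerSeries.map (MvPolynomial.eval a) (x j)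
  have hz : PowerSeries.map (MvPolynomial.eval a) F = MvPolynomial.eval z f := by
    rw [hFdef, MvPolynomial.hom_eval₂, MvPolynomial.eval₂_eq_eval_map, MvPolynomial.eval_map]
    have : (PowerSeries.map (MvPolynomial.eval a)).comp
        (PowerSeries.map (MvPolynomial.C (σ := Fin (M * v)))) = RingHom.id (PowerSeries k) := by
      ext g l; simp
    rw [this]
    rfl
  have hzdvd : X ^ r ∣ MvPolynomial.eval z f := by
    rw [← hz, X_pow_dvd_iff]
    intro l hl
    rw [coeff_map]
    exact ha ⟨l, hl⟩
  obtain ⟨c, hc⟩ := Function.ne_iff.1 ha0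
  set s₀ := (finProdFinEquiv.symm c).1
  set j₀ := (finProdFinEquiv.symm c).2
  have hcoeff : coeff (s₀ : ℕ) (z j₀) ≠ 0 := by
    have : coeff (s₀ : ℕ) (z j₀) = a c := by
      simp only [z, x, map_sum, map_mul]
      rw [Finset.sum_eq_single s₀]
      · have hc' : finProdFinEquiv (s₀, j₀) = c := by
          simp only [s₀, j₀, Prod.mk.eta, Equiv.apply_symm_apply]
        simp [hc']
      · intro b _ hb
        simp [Fin.val_inj, Ne.symm hb]
      · simp
    rw [this]; exact hc
  obtain ⟨s, hs, y, hy, hzy⟩ := exists_primitive_vector z hcoeff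
  refine ⟨y, hy, ?_⟩
  have hsc := hf.aeval_mul (X ^ s : PowerSeries k) y
  simp only [← hzy, MvPolynomial.aeval_eq_eval] at hsc
  change MvPolynomial.eval z f = _ at hsc
  rw [hsc, ← pow_mul] at hzdvd
  have hle : s * d + N ≤ r := by
    have : s ≤ M := hs.trans s₀.2.le
    have := Nat.mul_le_mul_left d this
    rw [hr, mul_comm s d]; omega
  have := (pow_dvd_pow X hle).trans hzdvd
  rw [pow_add] at this
  exact (mul_dvd_mul_iff_left (pow_ne_zero _ X_ne_zero)).1 this

end Approximation

/-! ### Newton's method over power series -/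

section Newton

open PowerSeries Polynomial

variable {k : Type*} [Field k]

theorem PowerSeries.exists_limit (A : ℕ → PowerSeries k) (c : ℕ)
    (hA : ∀ N, (PowerSeries.X : PowerSeries k) ^ (c + 1 + N) ∣ A (N + 1) - A N) :
    ∃ b, ∀ N, (PowerSeries.X : PowerSeries k) ^ (c + 1 + N) ∣ b - A N := by
  have hA' : ∀ N N', N ≤ N' → (PowerSeries.X : PowerSeries k) ^ (c + 1 + N) ∣ A N' - A N := by
    intro N N' h
    induction N', h using Nat.le_induction with
    | base => simp
    | succ N' h ih =>
      have := dvd_add ((pow_dvd_pow _ (by omega)).trans (hA N')) ih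
      simpa using this
  refine ⟨PowerSeries.mk fun m => PowerSeries.coeff m (A m), fun N => ?_⟩
  rw [PowerSeries.X_pow_dvd_iff]
  intro m hm
  rw [map_sub, PowerSeries.coeff_mk, ← map_sub]
  rcases le_total N m with h | h
  · exact PowerSeries.X_pow_dvd_iff.1 (hA' N m h) m hm
  · rw [← neg_sub, map_neg, PowerSeries.X_pow_dvd_iff.1 (hA' m N h) m (by omega), neg_zero]

/-- Newton's form of Hensel's lemma over `k⟦X⟧`. -/
theorem PowerSeries.exists_root_of_approx (g : Polynomial (PowerSeries k)) (a : PowerSeries k)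
    (c l : ℕ) (hc : ∃ u, IsUnit u ∧ g.derivative.eval a = PowerSeries.X ^ c * u)
    (ha : (PowerSeries.X : PowerSeries k) ^ (2 * c + l + 1) ∣ g.eval a) :
    ∃ b, g.eval b = 0 ∧ (PowerSeries.X : PowerSeries k) ^ (c + l + 1) ∣ b - a := by
  let Q : ℕ → PowerSeries k → Prop := fun N a =>
    (∃ u, IsUnit u ∧ g.derivative.eval a = PowerSeries.X ^ c * u) ∧
      (PowerSeries.X : PowerSeries k) ^ (2 * c + l + 1 + N) ∣ g.eval a
  have step : ∀ N a, ∃ a', Q N a → Q (N + 1) a' ∧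
      (PowerSeries.X : PowerSeries k) ^ (c + l + 1 + N) ∣ a' - a := by
    intro N a
    by_cases h : Q N a
    swap
    · exact ⟨0, fun h' => absurd h' h⟩
    obtain ⟨⟨u, hu, hga⟩, w, hw⟩ := h
    obtain ⟨u', hu'⟩ := hu.exists_right_inv
    set y : PowerSeries k := -(PowerSeries.X ^ (c + l + 1 + N) * (w * u')) with hy
    have hyd : (PowerSeries.X : PowerSeries k) ^ (c + l + 1 + N) ∣ y :=
      (dvd_neg.2 (dvd_mul_right _ _))
    refine ⟨a + y, fun _ => ⟨⟨?_, ?_⟩, by simpa using hyd⟩⟩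
    · have h1 : y ∣ g.derivative.eval (a + y) - g.derivative.eval a := by
        simpa using g.derivative.sub_dvd_eval_sub (a + y) a
      obtain ⟨v, hv⟩ := ((pow_dvd_pow (PowerSeries.X : PowerSeries k)
        (show c + 1 ≤ c + l + 1 + N by omega)).trans hyd).trans h1
      refine ⟨u + PowerSeries.X * v, ?_, ?_⟩
      · rw [PowerSeries.isUnit_iff_constantCoeff] at hu ⊢
        simpa using hu
      · rw [eq_add_of_sub_eq hv, hga]; ring
    · obtain ⟨z, hz⟩ := g.binomExpansion a y
      have h2 : g.eval a + g.derivative.eval a * y = 0 := by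
        rw [hga, hw, hy]
        linear_combination (-(PowerSeries.X ^ (2 * c + l + 1 + N) * w)) * hu'
      rw [hz, h2, zero_add, pow_two]
      refine Dvd.dvd.mul_left ((pow_dvd_pow _ ?_).trans
        ((pow_add (PowerSeries.X : PowerSeries k) _ _).dvd.trans (mul_dvd_mul hyd hyd))) _
      omega
  choose next hnext using step
  let A : ℕ → PowerSeries k := fun N => Nat.rec a (fun N b => next N b) N
  have hQ : ∀ N, Q N (A N) := by
    intro N
    induction N with
    | zero => exact ⟨hc, ha⟩
    | succ N ih => exact (hnext N (A N) ih).1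
  obtain ⟨b, hb⟩ := PowerSeries.exists_limit A (c + l) fun N => (hnext N (A N) (hQ N)).2
  refine ⟨b, ?_, hb 0⟩
  ext m
  have h1 : (PowerSeries.X : PowerSeries k) ^ (c + l + 1 + m) ∣ g.eval b := by
    have h2 := (hb m).trans (g.sub_dvd_eval_sub b (A m))
    have h3 := (pow_dvd_pow (PowerSeries.X : PowerSeries k)
      (show c + l + 1 + m ≤ 2 * c + l + 1 + m by omega)).trans (hQ m).2
    simpa using dvd_add h2 h3
  simpa using PowerSeries.X_pow_dvd_iff.1 h1 m (by omega)

end Newton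

/-! ### Specialization from power series over an ultrapower -/

section Specialization

open Polynomial

/-- Evaluation of a polynomial over `MvPolynomial ι O`. -/
noncomputable def evalPair {O S ι : Type*} [CommRing O] [CommRing S] (j : O →+* S) (τ : ι → S)
    (θ : S) : Polynomial (MvPolynomial ι O) →+* S :=
  Polynomial.eval₂RingHom (MvPolynomial.eval₂Hom j τ) θ

theorem map_evalPair {O S S' ι : Type*} [CommRing O] [CommRing S] [CommRing S'] (j : O →+* S)
    (τ : ι → S) (θ : S) (g : S →+* S') (q : Polynomial (MvPolynomial ι O)) :
    g (evalPair j τ θ q) = evalPair (g.comp j) (fun s => g (τ s)) (g θ) q := by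
  have : g.comp (evalPair j τ θ) = evalPair (g.comp j) (fun s => g (τ s)) (g θ) := by
    refine Polynomial.ringHom_ext' (MvPolynomial.ringHom_ext' ?_ fun s => ?_) ?_
    · ext; simp [evalPair]
    · simp [evalPair]
    · simp [evalPair]
  exact DFunLike.congr_fun this q

variable {k κ I : Type*} [Field k] [Field κ] [Algebra k κ]

/-- The algebra map `π` from a power of `k` behaves like the projection to an ultrapower. -/
structure IsUltrapowerMap (π : (I → k) →ₐ[k] κ) : Prop where
  surjective : Function.Surjective π
  exists_index : ∀ (F : Finset (I → k)) (s : I → k), (∀ r ∈ F, π r = 0) → π s ≠ 0 →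
    ∃ ν, (∀ r ∈ F, r ν = 0) ∧ s ν ≠ 0

theorem IsUltrapowerMap.exists_specialization {π : (I → k) →ₐ[k] κ} (hπ : IsUltrapowerMap π)
    {ι : Type*} (τ : ι → PowerSeries κ) (θ : PowerSeries κ)
    (μ q : Polynomial (MvPolynomial ι (PowerSeries k)))
    (hμ : evalPair (PowerSeries.map (algebraMap k κ)) τ θ μ = 0)
    (hμ' : evalPair (PowerSeries.map (algebraMap k κ)) τ θ μ.derivative ≠ 0)
    (hq : evalPair (PowerSeries.map (algebraMap k κ)) τ θ q ≠ 0) :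
    ∃ (τ₀ : ι → PowerSeries k) (θ₀ : PowerSeries k), evalPair (RingHom.id _) τ₀ θ₀ μ = 0 ∧
      evalPair (RingHom.id _) τ₀ θ₀ q ≠ 0 := by
  classical
  have hlift : ∀ y : PowerSeries κ, ∃ z : PowerSeries (I → k),
      PowerSeries.map (π : (I → k) →+* κ) z = y := fun y => by
    choose z hz using fun l => hπ.surjective (PowerSeries.coeff l y)
    exact ⟨PowerSeries.mk z, by ext l; simp [hz]⟩
  choose τ' hτ' using fun s => hlift (τ s)
  obtain ⟨θ', hθ'⟩ := hlift θ
  let E : Polynomial (MvPolynomial ι (PowerSeries k)) →+* PowerSeries (I → k) :=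
    evalPair (PowerSeries.map (algebraMap k (I → k))) τ' θ'
  have hE : ∀ p l, PowerSeries.coeff l (evalPair (PowerSeries.map (algebraMap k κ)) τ θ p) =
      π (PowerSeries.coeff l (E p)) := by
    intro p l
    have h1 := map_evalPair (PowerSeries.map (algebraMap k (I → k))) τ' θ'
      (PowerSeries.map (π : (I → k) →+* κ)) p
    have h2 : (PowerSeries.map (π : (I → k) →+* κ)).comp (PowerSeries.map (algebraMap k (I → k))) =
        PowerSeries.map (algebraMap k κ) := by
      ext g l
      simp [-Pi.algebraMap_apply]
    simp only [h2, hτ', hθ'] at h1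
    rw [← h1, PowerSeries.coeff_map]
    rfl
  have hEν : ∀ ν p l, PowerSeries.coeff l (evalPair (RingHom.id _)
      (fun s => PowerSeries.map (Pi.evalRingHom _ ν) (τ' s))
      (PowerSeries.map (Pi.evalRingHom _ ν) θ') p) = PowerSeries.coeff l (E p) ν := by
    intro ν p l
    have h1 := map_evalPair (PowerSeries.map (algebraMap k (I → k))) τ' θ'
      (PowerSeries.map (Pi.evalRingHom (fun _ => k) ν)) p
    have h2 : (PowerSeries.map (Pi.evalRingHom (fun _ => k) ν)).comp
        (PowerSeries.map (algebraMap k (I → k))) = RingHom.id _ := by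
      ext g l
      simp
    rw [h2] at h1
    rw [← h1, PowerSeries.coeff_map]
    rfl
  set D := evalPair (PowerSeries.map (algebraMap k κ)) τ θ μ.derivative with hD
  set Z := evalPair (PowerSeries.map (algebraMap k κ)) τ θ q with hZ
  obtain ⟨c, hc⟩ : ∃ c, c = D.order.toNat := ⟨_, rfl⟩
  obtain ⟨l, hl⟩ : ∃ l, l = Z.order.toNat := ⟨_, rfl⟩
  have hDc : PowerSeries.coeff c D ≠ 0 := by rw [hc]; exact PowerSeries.coeff_order hμ'
  have hDc' : ∀ m < c, PowerSeries.coeff m D = 0 := fun m hm =>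
    PowerSeries.coeff_of_lt_order_toNat m (hc ▸ hm)
  have hZl : PowerSeries.coeff l Z ≠ 0 := by rw [hl]; exact PowerSeries.coeff_order hq
  obtain ⟨ν, hν, hν'⟩ := hπ.exists_index
    (((Finset.range (2 * c + l + 1)).image fun m => PowerSeries.coeff m (E μ)) ∪
      ((Finset.range c).image fun m => PowerSeries.coeff m (E μ.derivative)))
    (PowerSeries.coeff c (E μ.derivative) * PowerSeries.coeff l (E q))
    (by
      intro r hr
      simp only [Finset.mem_union, Finset.mem_image, Finset.mem_range] at hr
      obtain ⟨m, hm, rfl⟩ | ⟨m, hm, rfl⟩ := hr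
      · rw [← hE, hμ, map_zero]
      · rw [← hE]; exact hDc' m hm)
    (by rw [map_mul, ← hE, ← hE]; exact mul_ne_zero hDc hZl)
  set τν := fun s => PowerSeries.map (Pi.evalRingHom (fun _ => k) ν) (τ' s)
  set θν := PowerSeries.map (Pi.evalRingHom (fun _ => k) ν) θ'
  have heval : ∀ (p : Polynomial (MvPolynomial ι (PowerSeries k))) b,
      evalPair (RingHom.id _) τν b p =
        (p.map (MvPolynomial.eval₂Hom (RingHom.id _) τν)).eval b := fun p b => by
    rw [Polynomial.eval_map]; rfl
  obtain ⟨b, hb, hbd⟩ := PowerSeries.exists_root_of_approx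
    (μ.map (MvPolynomial.eval₂Hom (RingHom.id _) τν)) θν c l
    (by
      rw [Polynomial.derivative_map, ← heval]
      obtain ⟨u, hu⟩ := (PowerSeries.X_pow_dvd_iff
        (φ := evalPair (RingHom.id _) τν θν μ.derivative) (n := c)).2 fun m hm => by
          rw [hEν]
          exact hν _ (Finset.mem_union_right _ (Finset.mem_image_of_mem _ (Finset.mem_range.2 hm)))
      refine ⟨u, ?_, hu⟩
      have h1 := hEν ν μ.derivative c
      rw [hu, PowerSeries.coeff_X_pow_mul' , if_pos le_rfl, Nat.sub_self,
        PowerSeries.coeff_zero_eq_constantCoeff_apply] at h1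
      rw [PowerSeries.isUnit_iff_constantCoeff, h1, isUnit_iff_ne_zero]
      exact left_ne_zero_of_mul hν')
    (by
      rw [← heval, PowerSeries.X_pow_dvd_iff]
      intro m hm
      rw [hEν]
      exact hν _ (Finset.mem_union_left _ (Finset.mem_image_of_mem _ (Finset.mem_range.2 hm))))
  refine ⟨τν, b, by rw [heval, hb], fun h0 => ?_⟩
  have h1 := hbd.trans (Polynomial.sub_dvd_eval_sub b θν
    (q.map (MvPolynomial.eval₂Hom (RingHom.id _) τν)))
  rw [← heval, ← heval, h0, zero_sub, dvd_neg, PowerSeries.X_pow_dvd_iff] at h1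
  have h2 := h1 l (by omega)
  rw [hEν] at h2
  exact right_ne_zero_of_mul hν' h2

end Specialization

/-! ### Descent of additive `p`-equations -/

section FrobeniusDescent

/-- Diagonal forms of degree `p` over `A` with a nontrivial zero in `B` have one in `A`. -/
def FrobeniusDescent {A B : Type*} [CommRing A] [CommRing B] (g : A →+* B) (p : ℕ) : Prop :=
  ∀ (r : ℕ) (e : Fin r → A) (w : Fin r → B), w ≠ 0 → ∑ j, g (e j) * w j ^ p = 0 →
    ∃ u : Fin r → A, u ≠ 0 ∧ ∑ j, e j * u j ^ p = 0

theorem FrobeniusDescent.of_comp {A B C : Type*} [CommRing A] [CommRing B] [CommRing C]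
    {g : A →+* B} {h : B →+* C} {p : ℕ} (hgh : FrobeniusDescent (h.comp g) p)
    (hh : Function.Injective h) : FrobeniusDescent g p := by
  intro r e w hw hs
  refine hgh r e (fun j => h (w j)) (fun h0 => hw ?_) ?_
  · ext j
    exact hh (by simpa using congrFun h0 j)
  · simpa using congrArg h hs

theorem FrobeniusDescent.of_isFractionRing {O P K W : Type*} [CommRing O] [CommRing P]
    [IsDomain O] [IsDomain P] [Field K] [Field W] [Algebra O K] [Algebra P W]
    [IsFractionRing O K] [IsFractionRing P W]
    {j : O →+* P} {g : K →+* W} {p : ℕ} (hj : FrobeniusDescent j p)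
    (hg : ∀ a, g (algebraMap O K a) = algebraMap P W (j a)) : FrobeniusDescent g p := by
  intro r e w hw hs
  obtain ⟨b, hb⟩ := IsLocalization.exist_integer_multiples_of_finite (nonZeroDivisors O) e
  obtain ⟨c, hc⟩ := IsLocalization.exist_integer_multiples_of_finite (nonZeroDivisors P) w
  choose e' he' using hb
  choose w' hw' using hc
  have hb0 : algebraMap O K b ≠ 0 := by simp
  simp only [Algebra.smul_def] at he' hw'
  have hw0 : w' ≠ 0 := fun h0 => hw <| by
    ext i
    have := hw' i
    rw [h0] at this
    simpa using this.symm
  have hs' : ∑ i, j (e' i) * w' i ^ p = 0 := by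
    apply IsFractionRing.injective P W
    simp only [map_sum, map_mul, map_pow, hw', map_zero, ← hg, he']
    have : ∀ i, g (algebraMap O K b) * g (e i) * (algebraMap P W c * w i) ^ p =
        g (algebraMap O K b) * algebraMap P W c ^ p * (g (e i) * w i ^ p) := fun i => by ring
    simp only [this, ← Finset.mul_sum, hs, mul_zero]
  obtain ⟨u, hu, hsum⟩ := hj r e' w' hw0 hs'
  refine ⟨fun i => algebraMap O K (u i), fun h0 => hu ?_, ?_⟩
  · ext i
    exact IsFractionRing.injective O K (by simpa using congrFun h0 i)
  · have := congrArg (algebraMap O K) hsum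
    simp only [map_sum, map_mul, map_pow, he', map_zero, mul_assoc] at this
    rw [← Finset.mul_sum] at this
    exact (mul_eq_zero.1 this).resolve_left hb0

section Field

variable {A B : Type*} [Field A] [Field B] [Algebra A B] {p : ℕ} [ExpChar B p]

theorem FrobeniusDescent.eq_zero_of_sum_pow
    (h : FrobeniusDescent (algebraMap A B) p) : ∀ (n : ℕ) (a : Fin n → B) (c : Fin n → A),
    LinearIndependent A a → ∑ i, c i • a i ^ p = 0 → c = 0 := by
  have : ExpChar A p := (algebraMap A B).expChar (algebraMap A B).injective p
  intro n
  induction n with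
  | zero => intros; exact Subsingleton.elim _ _
  | succ n ih =>
    intro a c ha hs
    simp only [Algebra.smul_def] at hs
    obtain ⟨u, hu, hus⟩ := h _ c a (fun h0 => ha.ne_zero 0 (congrFun h0 0)) hs
    obtain ⟨i₀, hi₀⟩ := Function.ne_iff.1 hu
    have hi₀ : u i₀ ≠ 0 := hi₀
    let a' : Fin n → B := fun i => a (i₀.succAbove i) - (u (i₀.succAbove i) / u i₀) • a i₀
    have hus' : c i₀ = - ∑ i, c (i₀.succAbove i) * (u (i₀.succAbove i) / u i₀) ^ p := by
      rw [Fin.sum_univ_succAbove _ i₀] at hus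
      have : ∀ i, c (i₀.succAbove i) * (u (i₀.succAbove i) / u i₀) ^ p =
        c (i₀.succAbove i) * u (i₀.succAbove i) ^ p * (u i₀ ^ p)⁻¹ := fun i => by
          rw [div_pow]; ring
      simp only [this, ← Finset.sum_mul]
      rw [← neg_mul, ← eq_neg_of_add_eq_zero_left hus, mul_assoc,
        mul_inv_cancel₀ (pow_ne_zero _ hi₀), mul_one]
    have ha' : LinearIndependent A a' := by
      rw [Fintype.linearIndependent_iff] at ha ⊢
      intro g hg i
      let G : Fin (n + 1) → A :=
        i₀.insertNth (- ∑ i, g i * (u (i₀.succAbove i) / u i₀)) g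
      have hG := ha G (by
        rw [Fin.sum_univ_succAbove _ i₀]
        simp only [G, Fin.insertNth_apply_same, Fin.insertNth_apply_succAbove]
        simp only [a', smul_sub, Finset.sum_sub_distrib, smul_smul] at hg
        rw [← Finset.sum_smul] at hg
        rw [neg_smul]
        linear_combination hg)
      simpa [G] using hG (i₀.succAbove i)
    have hc : (fun i => c (i₀.succAbove i)) = 0 := by
      refine ih a' _ ha' ?_
      simp only [a', sub_pow_expChar, smul_sub, Finset.sum_sub_distrib, smul_pow, smul_smul]
      rw [← Finset.sum_smul, ← neg_eq_iff_eq_neg.2 hus', neg_smul, sub_neg_eq_add, add_comm]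
      rw [Fin.sum_univ_succAbove _ i₀] at hs
      simpa only [Algebra.smul_def] using hs
    ext i
    rcases Fin.eq_self_or_eq_succAbove i₀ i with rfl | ⟨j, rfl⟩
    · have : ∀ j, c (i.succAbove j) = 0 := fun j => congrFun hc j
      simpa [this] using hus'
    · exact congrFun hc j

theorem FrobeniusDescent.linearIndependent_pow (h : FrobeniusDescent (algebraMap A B) p)
    {ι : Type*} {a : ι → B} (ha : LinearIndependent A a) :
    LinearIndependent A fun i => a i ^ p := by
  rw [linearIndependent_iff_finset_linearIndependent]
  intro s
  rw [← linearIndependent_equiv s.equivFin.symm, Fintype.linearIndependent_iff]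
  intro c hc i
  refine congrFun (h.eq_zero_of_sum_pow _ (fun i => a (s.equivFin.symm i)) c ?_ ?_) i
  · exact ha.comp _ (Subtype.val_injective.comp s.equivFin.symm.injective)
  · simpa using hc

/-- Every linear functional `φ` is compatible with a functional `ψ` on `p`-th powers. -/
theorem FrobeniusDescent.exists_dual (h : FrobeniusDescent (algebraMap A B) p)
    (φ : B →ₗ[A] A) : ∃ ψ : B →ₗ[A] A, ∀ w, ψ (w ^ p) = φ w ^ p := by
  have : ExpChar A p := (algebraMap A B).expChar (algebraMap A B).injective p
  let b := Module.Basis.ofVectorSpace A B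
  have hb := h.linearIndependent_pow b.linearIndependent
  obtain ⟨ψ, hψ⟩ := LinearMap.exists_extend
    ((Finsupp.lift A A _ fun i => φ (b i) ^ p).comp hb.repr)
  have hψb : ∀ i, ψ (b i ^ p) = φ (b i) ^ p := by
    intro i
    have := DFunLike.congr_fun hψ ⟨b i ^ p, Submodule.subset_span ⟨i, rfl⟩⟩
    simp only [LinearMap.comp_apply, Submodule.subtype_apply] at this
    rw [this]
    erw [LinearIndependent.repr_eq_single hb i _ rfl]
    simp
  refine ⟨ψ, fun w => ?_⟩
  conv_lhs => rw [← b.linearCombination_repr w]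
  conv_rhs => rw [← b.linearCombination_repr w]
  rw [Finsupp.linearCombination_apply, Finsupp.sum, sum_pow_char, map_sum, map_sum,
    sum_pow_char]
  simp [smul_pow, mul_pow, hψb]

end Field

theorem IsUltrapowerMap.frobeniusDescent {k κ I : Type*} [Field k] [Field κ] [Algebra k κ]
    {π : (I → k) →ₐ[k] κ} (hπ : IsUltrapowerMap π) (p : ℕ) :
    FrobeniusDescent (algebraMap k κ) p := by
  intro r e w hw hs
  obtain ⟨j, hj⟩ := Function.ne_iff.1 hw
  choose z hz using fun j => hπ.surjective (w j)
  obtain ⟨ν, h1, h2⟩ := hπ.exists_index {∑ j, algebraMap k (I → k) (e j) * z j ^ p} (z j) (by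
    simp only [Finset.mem_singleton, forall_eq, map_sum, map_mul, map_pow, AlgHom.commutes, hz]
    exact hs) (by rw [hz]; exact hj)
  refine ⟨fun j => z j ν, fun h0 => h2 (congrFun h0 j), ?_⟩
  simpa using h1

theorem PowerSeries.coeff_pow_expChar {R : Type*} [CommRing R] (p : ℕ) [ExpChar R p]
    (y : PowerSeries R) (l : ℕ) : PowerSeries.coeff l (y ^ p) =
      if p ∣ l then PowerSeries.coeff (l / p) y ^ p else 0 := by
  have h : (y.expand p (expChar_ne_zero R p)).map (frobenius R p) = y ^ p :=
    MvPowerSeries.map_frobenius_expand p (expChar_ne_zero R p)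
  rw [← h, PowerSeries.coeff_map, PowerSeries.coeff_expand]
  split_ifs <;> simp [frobenius_def, expChar_ne_zero R p]

theorem FrobeniusDescent.powerSeries {A B : Type*} [Field A] [Field B] [Algebra A B] {p : ℕ}
    [ExpChar B p] (h : FrobeniusDescent (algebraMap A B) p) :
    FrobeniusDescent (PowerSeries.map (algebraMap A B)) p := by
  have : ExpChar A p := (algebraMap A B).expChar (algebraMap A B).injective p
  intro r e y hy hs
  obtain ⟨j₀, hj₀⟩ := Function.ne_iff.1 hy
  obtain ⟨l₀, hl₀⟩ : ∃ l, PowerSeries.coeff l (y j₀) ≠ 0 := by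
    by_contra! h0
    exact hj₀ (PowerSeries.ext h0)
  obtain ⟨φ, hφ⟩ : ∃ φ : B →ₗ[A] A, φ (PowerSeries.coeff l₀ (y j₀)) ≠ 0 := by
    by_contra! h0
    exact hl₀ ((Module.forall_dual_apply_eq_zero_iff A _).1 h0)
  obtain ⟨ψ, hψ⟩ := h.exists_dual φ
  refine ⟨fun j => PowerSeries.mk fun l => φ (PowerSeries.coeff l (y j)), fun h0 => hφ ?_, ?_⟩
  · simpa using congrArg (PowerSeries.coeff l₀) (congrFun h0 j₀)
  · ext l
    have := congrArg (fun s => ψ (PowerSeries.coeff l s)) hs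
    simp only [map_sum, PowerSeries.coeff_mul, PowerSeries.coeff_map, map_zero,
      ← Algebra.smul_def, map_smul, smul_eq_mul] at this ⊢
    rw [← this]
    refine Finset.sum_congr rfl fun j _ => Finset.sum_congr rfl fun q _ => ?_
    congr 1
    rw [PowerSeries.coeff_pow_expChar, PowerSeries.coeff_pow_expChar]
    split_ifs <;> simp [hψ]

end FrobeniusDescent

/-! ### Integral models of separably generated extensions -/

section Model

open Polynomial IntermediateField

theorem MvPolynomial.exists_map_eq_C_mul {O K : Type*} [CommRing O] [IsDomain O] [Field K]
    [Algebra O K] [IsFractionRing O K] {ι : Type*} (p : MvPolynomial ι K) :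
    ∃ c : O, c ≠ 0 ∧ ∃ a : MvPolynomial ι O,
      MvPolynomial.map (algebraMap O K) a = MvPolynomial.C (algebraMap O K c) * p := by
  induction p using MvPolynomial.induction_on with
  | C r =>
    obtain ⟨n, d, hd, rfl⟩ := IsFractionRing.div_surjective (A := O) r
    have hd0 : d ≠ 0 := nonZeroDivisors.ne_zero hd
    refine ⟨d, hd0, MvPolynomial.C n, ?_⟩
    have : algebraMap O K d ≠ 0 := by simpa using hd0
    rw [MvPolynomial.map_C, ← map_mul, mul_div_cancel₀ _ this]
  | add p q hp hq =>
    obtain ⟨c, hc, a, ha⟩ := hp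
    obtain ⟨d, hd, b, hb⟩ := hq
    refine ⟨c * d, mul_ne_zero hc hd, MvPolynomial.C d * a + MvPolynomial.C c * b, ?_⟩
    simp only [map_add, map_mul, MvPolynomial.map_C, ha, hb]
    ring
  | mul_X p i hp =>
    obtain ⟨c, hc, a, ha⟩ := hp
    exact ⟨c, hc, a * MvPolynomial.X i, by rw [map_mul, ha, MvPolynomial.map_X, mul_assoc]⟩

/-- A finite separable extension of the fraction field of `A` has an integral generator. -/
theorem exists_integral_generator {A E L σ : Type*} [CommRing A] [IsDomain A]
    [IsIntegrallyClosed A] [Field E] [Field L] [Algebra A E] [IsFractionRing A E] [Algebra E L]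
    [Algebra A L] [IsScalarTower A E L] [Module.Finite E L] [Algebra.IsSeparable E L] [Finite σ]
    (x : σ → L) :
    ∃ θ : L, IsIntegral A θ ∧ aeval θ (derivative (minpoly A θ)) ≠ 0 ∧
      ∃ b : A, b ≠ 0 ∧ ∃ q : σ → A[X], ∀ j, aeval θ (q j) = algebraMap A L b * x j := by
  classical
  cases nonempty_fintype σ
  obtain ⟨θ₁, hθ₁⟩ := Field.exists_primitive_element E L
  have halg : IsAlgebraic A θ₁ := by
    rw [IsFractionRing.isAlgebraic_iff A E L]
    exact Algebra.IsAlgebraic.isAlgebraic θ₁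
  obtain ⟨c, hc, hint⟩ := halg.exists_integral_multiple
  have hcE : algebraMap A E c ≠ 0 := by simpa using hc
  have hθ : E⟮c • θ₁⟯ = ⊤ := by
    rw [eq_top_iff, ← hθ₁, adjoin_simple_le_iff]
    have := mul_mem (IntermediateField.algebraMap_mem E⟮c • θ₁⟯ (algebraMap A E c)⁻¹)
      (mem_adjoin_simple_self E (c • θ₁))
    rwa [← Algebra.smul_def, ← IsScalarTower.algebraMap_smul E c θ₁, smul_smul,
      inv_mul_cancel₀ hcE, one_smul, IsScalarTower.algebraMap_smul] at this
  have hmin := minpoly.isIntegrallyClosed_eq_field_fractions' E hint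
  refine ⟨c • θ₁, hint, ?_, ?_⟩
  · have := (Algebra.IsSeparable.isSeparable E (c • θ₁)).aeval_derivative_ne_zero
      (minpoly.aeval E (c • θ₁))
    rwa [hmin, derivative_map, aeval_map_algebraMap] at this
  · have hpoly : ∀ z : L, ∃ p : E[X], aeval (c • θ₁) p = z := fun z => by
      have hz : z ∈ E⟮c • θ₁⟯.toSubalgebra := by rw [hθ]; trivial
      rw [adjoin_simple_toSubalgebra_of_isAlgebraic (Algebra.IsAlgebraic.isAlgebraic _),
        Algebra.adjoin_singleton_eq_range_aeval] at hz
      exact hz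
    choose p hp using fun j => hpoly (x j)
    choose b hb hq using fun j =>
      IsLocalization.integerNormalization_spec (nonZeroDivisors A) (p j)
    choose d hd using fun j => Finset.dvd_prod_of_mem b (Finset.mem_univ j)
    refine ⟨∏ j, b j, Finset.prod_ne_zero_iff.2 fun j _ => nonZeroDivisors.ne_zero (hb j),
      fun j => C (d j) * IsLocalization.integerNormalization (nonZeroDivisors A) (p j),
      fun j => ?_⟩
    rw [map_mul, aeval_C, ← aeval_map_algebraMap E (c • θ₁)
      (IsLocalization.integerNormalization (nonZeroDivisors A) (p j)), hq j, hd j, map_mul,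
      ← hp j, ← IsScalarTower.algebraMap_smul E (b j) (p j), map_smul,
      IsScalarTower.algebraMap_smul, Algebra.smul_def]
    ring

theorem AlgebraicIndependent.smul_of_ne_zero {K L ι : Type*} [Field K] [Field L] [Algebra K L]
    {t : ι → L} (ht : AlgebraicIndependent K t) {c : ι → K} (hc : ∀ i, c i ≠ 0) :
    AlgebraicIndependent K fun i => c i • t i := by
  let σ (c : ι → K) : MvPolynomial ι K →ₐ[K] MvPolynomial ι K :=
    MvPolynomial.aeval fun i => c i • MvPolynomial.X i
  have h1 : (σ fun i => (c i)⁻¹).comp (σ c) = AlgHom.id K _ := by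
    ext i : 1
    simp [σ, smul_smul, hc i]
  have h2 : MvPolynomial.aeval (fun i => c i • t i) = (MvPolynomial.aeval t).comp (σ c) := by
    ext i : 1
    simp [σ]
  rw [AlgebraicIndependent, h2, AlgHom.coe_comp]
  refine Function.Injective.comp ht (Function.LeftInverse.injective (g := σ fun i => (c i)⁻¹) ?_)
  exact fun p => DFunLike.congr_fun h1 p

theorem IntermediateField.adjoin_range_smul {K L ι : Type*} [Field K] [Field L] [Algebra K L]
    (t : ι → L) {c : ι → K} (hc : ∀ i, c i ≠ 0) :
    adjoin K (Set.range fun i => c i • t i) = adjoin K (Set.range t) := by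
  apply le_antisymm <;> rw [adjoin_le_iff] <;> rintro _ ⟨i, rfl⟩
  · exact IntermediateField.smul_mem _ (subset_adjoin K _ (Set.mem_range_self i))
  · have : (c i)⁻¹ • c i • t i ∈ adjoin K (Set.range fun i => c i • t i) :=
      IntermediateField.smul_mem _ (subset_adjoin K _ (Set.mem_range_self i))
    rwa [smul_smul, inv_mul_cancel₀ (hc i), one_smul] at this

theorem exists_div_of_mem_adjoin_range {O K L ι : Type*} [CommRing O] [IsDomain O] [Field K]
    [Field L] [Algebra O K] [IsFractionRing O K] [Algebra K L] [Algebra O L]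
    [IsScalarTower O K L] (t : ι → L) {z : L} (hz : z ∈ adjoin K (Set.range t)) :
    ∃ a b : MvPolynomial ι O, z = MvPolynomial.aeval t a / MvPolynomial.aeval t b := by
  obtain ⟨r, s, rfl⟩ := (mem_adjoin_range_iff K t z).1 hz
  obtain ⟨c, hc, a, ha⟩ := MvPolynomial.exists_map_eq_C_mul (O := O) r
  obtain ⟨d, hd, b, hb⟩ := MvPolynomial.exists_map_eq_C_mul (O := O) s
  have ha' := congrArg (MvPolynomial.aeval t) ha
  have hb' := congrArg (MvPolynomial.aeval t) hb
  rw [MvPolynomial.aeval_map_algebraMap, map_mul, MvPolynomial.aeval_C] at ha' hb'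
  have hcK : algebraMap K L (algebraMap O K c) ≠ 0 := by simpa using hc
  have hdK : algebraMap K L (algebraMap O K d) ≠ 0 := by simpa using hd
  refine ⟨MvPolynomial.C d * a, MvPolynomial.C c * b, ?_⟩
  rw [map_mul, map_mul, MvPolynomial.aeval_C, MvPolynomial.aeval_C, ha', hb',
    IsScalarTower.algebraMap_apply O K L, IsScalarTower.algebraMap_apply O K L]
  rw [show ∀ u v w y : L, u * (v * w) / (v * (u * y)) = (u * v * w) / (u * v * y) by
    intros; ring_nf, mul_div_mul_left _ _ (mul_ne_zero hdK hcK)]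

theorem exists_integral_model {O P K W σ : Type*} [CommRing O] [IsDomain O]
    [UniqueFactorizationMonoid O] [CommRing P] [IsDomain P] [IsIntegrallyClosed P]
    [Field K] [Field W] [Algebra O K] [IsFractionRing O K] [Algebra P W] [IsFractionRing P W]
    [Algebra K W] (g : O →+* P)
    (hg : ∀ a, algebraMap K W (algebraMap O K a) = algebraMap P W (g a))
    (hscale : ∀ w : W, ∃ c : O, c ≠ 0 ∧ ∃ y : P,
      algebraMap P W y = algebraMap K W (algebraMap O K c) * w)
    (L : IntermediateField K W) [Algebra.EssFiniteType K L]
    (hsep : ∃ s : Finset L, IsTranscendenceBasis K ((↑) : s → L) ∧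
      Algebra.IsSeparable (adjoin K (s : Set L)) L)
    [Finite σ] (x : σ → P) (hx : ∀ j, algebraMap P W (x j) ∈ L) :
    ∃ (s : Finset L) (τ : s → P) (θ : P) (μ : (MvPolynomial s O)[X]),
      evalPair g τ θ μ = 0 ∧ evalPair g τ θ (derivative μ) ≠ 0 ∧
      (∀ q, evalPair g τ θ q = 0 → μ ∣ q) ∧
      ∃ b : P, b ≠ 0 ∧ ∃ q : σ → (MvPolynomial s O)[X], ∀ j, evalPair g τ θ (q j) = b * x j := by
  obtain ⟨s, hs, hsep⟩ := hsep
  choose c hc τ hτ using fun i : s => hscale ((i : L) : W)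
  have hcK : ∀ i, algebraMap O K (c i) ≠ 0 := fun i => by simpa using hc i
  let t : s → L := fun i => algebraMap O K (c i) • (i : L)
  have htτ : ∀ i, algebraMap P W (τ i) = algebraMap L W (t i) := fun i => by
    rw [hτ, ← Algebra.smul_def]; rfl
  have ht : AlgebraicIndependent K t := hs.1.smul_of_ne_zero hcK
  have hadj : adjoin K (s : Set L) = adjoin K (Set.range t) := by
    rw [adjoin_range_smul _ hcK]
    simp
  rw [hadj] at hsep
  let E := adjoin K (Set.range t)
  let : Algebra O L := ((algebraMap K L).comp (algebraMap O K)).toAlgebra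
  have : IsScalarTower O K L := .of_algebraMap_eq fun _ => rfl
  let : Algebra (MvPolynomial s O) L := (MvPolynomial.eval₂Hom (algebraMap O L) t).toAlgebra
  have htE : ∀ a : MvPolynomial s O, algebraMap _ L a ∈ E := fun a => by
    induction a using MvPolynomial.induction_on with
    | C r =>
      rw [RingHom.algebraMap_toAlgebra, MvPolynomial.coe_eval₂Hom, MvPolynomial.eval₂_C]
      exact E.algebraMap_mem (algebraMap O K r)
    | add p q hp hq => rw [map_add]; exact add_mem hp hq
    | mul_X p i hp =>
      rw [map_mul]
      refine mul_mem hp ?_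
      rw [RingHom.algebraMap_toAlgebra, MvPolynomial.coe_eval₂Hom, MvPolynomial.eval₂_X]
      exact subset_adjoin K _ (Set.mem_range_self i)
  let : Algebra (MvPolynomial s O) E :=
    ((algebraMap (MvPolynomial s O) L).codRestrict E.toSubring htE).toAlgebra
  have : IsScalarTower (MvPolynomial s O) E L := .of_algebraMap_eq fun _ => rfl
  have hinj : Function.Injective (algebraMap (MvPolynomial s O) L) :=
    ht.restrictScalars (IsFractionRing.injective O K)
  have : FaithfulSMul (MvPolynomial s O) E := by
    rw [faithfulSMul_iff_algebraMap_injective]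
    exact fun a b hab => hinj (congrArg (algebraMap E L) hab)
  have : IsFractionRing (MvPolynomial s O) E := by
    refine IsFractionRing.of_field _ _ fun z => ?_
    obtain ⟨a, b, hab⟩ := exists_div_of_mem_adjoin_range (O := O) t z.2
    exact ⟨a, b, Subtype.ext hab⟩
  have : Algebra.EssFiniteType E L := .of_comp K E L
  have : Module.Finite E L := Algebra.finite_of_essFiniteType_of_isAlgebraic
  obtain ⟨θ, hθ, hder, b, hb, q, hq⟩ := exists_integral_generator (A := MvPolynomial s O)
    (E := E) fun j => (⟨algebraMap P W (x j), hx j⟩ : L)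
  have hcoe : ∀ q, algebraMap L W (aeval θ q) =
      evalPair ((algebraMap P W).comp g) (fun i => algebraMap P W (τ i)) (algebraMap L W θ) q := by
    intro q
    have h1 : aeval θ q = evalPair (algebraMap O L) t θ q := rfl
    rw [h1, map_evalPair]
    congr 2
    · ext a; exact hg a
    · ext i; exact (htτ i).symm
  have hθP : IsIntegral P (algebraMap L W θ) := by
    refine hθ.map_of_comp_eq (MvPolynomial.eval₂Hom g τ) (algebraMap L W) ?_
    refine MvPolynomial.ringHom_ext' ?_ fun i => ?_
    · ext a
      simpa [RingHom.algebraMap_toAlgebra] using (hg a).symm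
    · simpa [RingHom.algebraMap_toAlgebra] using htτ i
  obtain ⟨θ', hθ'⟩ := IsIntegrallyClosed.isIntegral_iff.1 hθP
  have key : ∀ q, algebraMap P W (evalPair g τ θ' q) = algebraMap L W (aeval θ q) := fun q => by
    rw [hcoe, map_evalPair, hθ']
  have key0 : ∀ q, evalPair g τ θ' q = 0 ↔ aeval θ q = 0 := fun q => by
    rw [← map_eq_zero_iff _ (IsFractionRing.injective P W), key, map_eq_zero]
  have : Module.IsTorsionFree (MvPolynomial s O) L := .trans_faithfulSMul _ E L
  refine ⟨s, τ, θ', minpoly _ θ, (key0 _).2 (minpoly.aeval _ _), (key0 _).not.2 hder,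
    fun q hq => minpoly.isIntegrallyClosed_dvd hθ ((key0 q).1 hq),
    evalPair g τ θ' (C b), (key0 _).not.2 ?_, q, fun j => ?_⟩
  · rw [aeval_C]
    exact (map_ne_zero_iff _ hinj).2 hb
  · apply IsFractionRing.injective P W
    rw [key, hq, map_mul, map_mul, key, aeval_C]
    rfl

end Model

/-! ### Zeros over power series rings -/

section Zeros

open IntermediateField

theorem PowerSeries.exists_X_pow_mul_mem {κ W : Type*} [Field κ] [Field W]
    [Algebra (PowerSeries κ) W] [IsFractionRing (PowerSeries κ) W] (w : W) :
    ∃ (n : ℕ) (y : PowerSeries κ),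
      algebraMap _ W y = algebraMap _ W (PowerSeries.X ^ n : PowerSeries κ) * w := by
  obtain ⟨a, b, hb, rfl⟩ := IsFractionRing.div_surjective (A := PowerSeries κ) w
  have hb0 : b ≠ 0 := nonZeroDivisors.ne_zero hb
  obtain ⟨u, hu⟩ := PowerSeries.isUnit_divided_by_X_pow_order hb0
  refine ⟨b.order.toNat, a * ↑u⁻¹, ?_⟩
  have hbW : algebraMap _ W b ≠ 0 := by simpa using hb0
  rw [mul_div_assoc', eq_div_iff hbW, ← map_mul, ← map_mul]
  congr 1
  conv_lhs => rw [← PowerSeries.X_pow_order_mul_divXPowOrder (f := b), ← hu]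
  linear_combination (a * PowerSeries.X ^ b.order.toNat) * u.inv_mul

theorem exists_separating_transcendenceBasis {K L : Type*} [Field K] [Field L] [Algebra K L]
    [Algebra.EssFiniteType K L]
    (h : ∀ p : ℕ, p.Prime → CharP K p → FrobeniusDescent (algebraMap K L) p) :
    ∃ s : Finset L, IsTranscendenceBasis K ((↑) : s → L) ∧
      Algebra.IsSeparable (adjoin K (s : Set L)) L := by
  obtain _ | ⟨p, hp, hpK⟩ := CharP.exists' K
  · exact exists_isTranscendenceBasis_and_isSeparable_of_perfectField K L
  · have : ExpChar K p := .prime hp.out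
    have : ExpChar L p := expChar_of_injective_algebraMap (algebraMap K L).injective p
    exact exists_isTranscendenceBasis_and_isSeparable_of_linearIndepOn_pow_of_essFiniteType p
      hp.out fun s hs => (h p hp.out hpK).linearIndependent_pow hs

theorem evalPair_eval₂ {O S ι σ : Type*} [CommRing O] [CommRing S] (f : MvPolynomial σ O)
    (q : σ → Polynomial (MvPolynomial ι O)) (g : O →+* S) (τ : ι → S) (θ : S) :
    evalPair g τ θ (MvPolynomial.eval₂ (Polynomial.C.comp MvPolynomial.C) q f) =
      MvPolynomial.eval₂ g (fun j => evalPair g τ θ (q j)) f := by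
  rw [MvPolynomial.hom_eval₂]
  congr 1
  ext1 a
  simp [evalPair]

theorem IsUltrapowerMap.exists_zero {k κ I : Type*} [Field k] [Field κ] [Algebra k κ]
    {π : (I → k) →ₐ[k] κ} (hπ : IsUltrapowerMap π) {v d : ℕ}
    {f : MvPolynomial (Fin v) (PowerSeries k)} (hf : f.IsHomogeneous d)
    {x : Fin v → PowerSeries κ} (hx : x ≠ 0)
    (hfx : MvPolynomial.eval₂ (PowerSeries.map (algebraMap k κ)) x f = 0) :
    ∃ y : Fin v → PowerSeries k, y ≠ 0 ∧ MvPolynomial.eval y f = 0 := by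
  let K := FractionRing (PowerSeries k)
  let W := FractionRing (PowerSeries κ)
  let g : PowerSeries k →+* PowerSeries κ := PowerSeries.map (algebraMap k κ)
  have hginj : Function.Injective ((algebraMap (PowerSeries κ) W).comp g) :=
    (IsFractionRing.injective (PowerSeries κ) W).comp
      (PowerSeries.map_injective _ (algebraMap k κ).injective)
  let : Algebra K W := (IsFractionRing.lift hginj).toAlgebra
  have hg : ∀ a, algebraMap K W (algebraMap _ K a) = algebraMap _ W (g a) := fun a =>
    IsFractionRing.lift_algebraMap hginj a
  let L : IntermediateField K W := adjoin K (Set.range fun j => algebraMap _ W (x j))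
  have : Algebra.EssFiniteType K L :=
    essFiniteType_iff.2 (fg_adjoin_of_finite (Set.finite_range _))
  have hsep := exists_separating_transcendenceBasis (K := K) (L := L) fun p hp hpK => by
    have : ExpChar K p := .prime hp
    have : ExpChar k p := ((algebraMap (PowerSeries k) K).comp PowerSeries.C).expChar
      (RingHom.injective _) p
    have : ExpChar κ p := expChar_of_injective_algebraMap (algebraMap k κ).injective p
    have h1 : FrobeniusDescent (algebraMap K W) p :=
      (hπ.frobeniusDescent p).powerSeries.of_isFractionRing hg
    exact FrobeniusDescent.of_comp (h := algebraMap L W) h1 (algebraMap L W).injective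
  obtain ⟨s, τ, θ, μ, hμ, hμ', hdvd, b, hb, q, hq⟩ := exists_integral_model g hg (fun w => by
    obtain ⟨n, y, hy⟩ := PowerSeries.exists_X_pow_mul_mem (κ := κ) w
    exact ⟨PowerSeries.X ^ n, pow_ne_zero _ PowerSeries.X_ne_zero, y, by
      rw [hy, hg, map_pow g, PowerSeries.map_X]⟩) L hsep x
    fun j => subset_adjoin K _ (Set.mem_range_self j)
  obtain ⟨j₀, hj₀⟩ := Function.ne_iff.1 hx
  obtain ⟨τ₀, θ₀, h0, hne⟩ := hπ.exists_specialization τ θ μ (q j₀) hμ hμ' (by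
    rw [hq]; exact mul_ne_zero hb hj₀)
  refine ⟨fun j => evalPair (RingHom.id _) τ₀ θ₀ (q j), fun h => hne (congrFun h j₀), ?_⟩
  obtain ⟨r, hr⟩ := hdvd (MvPolynomial.eval₂ (Polynomial.C.comp MvPolynomial.C) q f) (by
    let : Algebra (PowerSeries k) (PowerSeries κ) := g.toAlgebra
    have := hf.aeval_mul b x
    rw [evalPair_eval₂, funext hq]
    refine this.trans ?_
    rw [MvPolynomial.aeval_def]
    exact mul_eq_zero_of_right _ hfx)
  have := evalPair_eval₂ f q (RingHom.id _) τ₀ θ₀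
  rw [hr, map_mul, h0, zero_mul] at this
  exact this.symm

theorem IsCField.exists_zero_powerSeries {k : Type*} [Field k] {i : ℕ} (hk : IsCField i k)
    {d v : ℕ} (hd : 1 ≤ d) (hv : d ^ (i + 1) < v) {f : MvPolynomial (Fin v) (PowerSeries k)}
    (hf : f.IsHomogeneous d) :
    ∃ y : Fin v → PowerSeries k, y ≠ 0 ∧ MvPolynomial.eval y f = 0 := by
  let U : Filter ℕ := Filter.hyperfilter ℕ
  let κ := Filter.Germ U k
  let ρ : (ℕ → k) →+* κ := Filter.Germ.coeRingHom U
  let : Algebra k κ := (ρ.comp (algebraMap k (ℕ → k))).toAlgebra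
  let π : (ℕ → k) →ₐ[k] κ := { ρ with commutes' := fun _ => rfl }
  have hπ0 : ∀ r, π r = 0 ↔ ∀ᶠ ν in U, r ν = 0 := fun r => Filter.Germ.coe_eq
  have hπ : IsUltrapowerMap π :=
    { surjective := fun a => a.inductionOn fun r => ⟨r, rfl⟩
      exists_index := fun F s hF hs => by
        rw [Ne, hπ0, ← Ultrafilter.eventually_not] at hs
        have hF' := (Filter.eventually_all_finset F).2 fun r hr => (hπ0 r).1 (hF r hr)
        exact (hF'.and hs).exists }
  choose y hy hdvd using hk.exists_approximate_zero hd hv hf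
  obtain ⟨j₀, hj₀⟩ := Ultrafilter.eventually_exists_iff.1
    (Filter.Eventually.of_forall hy : ∀ᶠ N in U, ∃ j, PowerSeries.constantCoeff (y N j) ≠ 0)
  let z : Fin v → PowerSeries (ℕ → k) := fun j =>
    PowerSeries.mk fun l N => PowerSeries.coeff l (y N j)
  have hz : ∀ N j, PowerSeries.map (Pi.evalRingHom (fun _ => k) N) (z j) = y N j := fun N j => by
    ext l; simp [z]
  refine hπ.exists_zero hf (x := fun j => PowerSeries.map (π : (ℕ → k) →+* κ) (z j))
    (fun h => ?_) ?_
  · have h1 := congrArg (PowerSeries.coeff 0) (congrFun h j₀)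
    rw [Ultrafilter.eventually_not] at hj₀
    refine hj₀ ((hπ0 _).1 ?_)
    rw [PowerSeries.coeff_map] at h1
    simpa [z] using h1
  · have hmap : PowerSeries.map (algebraMap k κ) = (PowerSeries.map (π : (ℕ → k) →+* κ)).comp
        (PowerSeries.map (algebraMap k (ℕ → k))) := by
      ext a l
      simp
    rw [hmap, ← MvPolynomial.hom_eval₂]
    ext l
    rw [PowerSeries.coeff_map, map_zero]
    refine (hπ0 _).2 ?_
    have hU : ∀ᶠ N in U, l < N :=
      (Filter.hyperfilter_le_cofinite).trans Nat.cofinite_eq_atTop.le (Filter.eventually_gt_atTop l)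
    filter_upwards [hU] with N hN
    have h2 := PowerSeries.X_pow_dvd_iff.1 (hdvd N) l hN
    have h3 : PowerSeries.map (Pi.evalRingHom (fun _ => k) N)
        (MvPolynomial.eval₂ (PowerSeries.map (algebraMap k (ℕ → k))) z f) =
          MvPolynomial.eval (y N) f := by
      rw [MvPolynomial.hom_eval₂, MvPolynomial.eval, MvPolynomial.coe_eval₂Hom]
      have hid : (PowerSeries.map (Pi.evalRingHom (fun _ => k) N)).comp
          (PowerSeries.map (algebraMap k (ℕ → k))) = RingHom.id _ := by
        ext a l
        simp
      rw [hid, funext (hz N)]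
    rw [← h3] at h2
    simpa using h2

end Zeros

/-- **Greenberg's theorem**. If `k` is a `C_i` field, then the field `k((t))` of formal
Laurent series over `k` is a `C_{i+1}` field. -/
theorem greenberg_laurent_series (k : Type*) [Field k] (i : ℕ) (hk : IsCField i k) :
    IsCField (i + 1) (LaurentSeries k) := by
  intro n m hm hmn f hf
  obtain ⟨c, hc, a, ha⟩ := MvPolynomial.exists_map_eq_C_mul (O := PowerSeries k) f
  have hinj := IsFractionRing.injective (PowerSeries k) (LaurentSeries k)
  have hah : a.IsHomogeneous m := by
    refine .of_map hinj ?_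
    rw [ha]
    simpa using (MvPolynomial.isHomogeneous_C _ _).mul hf
  obtain ⟨y, hy, hay⟩ := hk.exists_zero_powerSeries hm (Nat.lt_succ_of_le hmn) hah
  refine ⟨fun j => algebraMap _ _ (y j), fun h => hy ?_, ?_⟩
  · ext1 j
    exact hinj (by simpa using congrFun h j)
  · have h1 := congrArg (algebraMap (PowerSeries k) (LaurentSeries k)) hay
    rw [map_zero, MvPolynomial.eval, MvPolynomial.coe_eval₂Hom, MvPolynomial.hom_eval₂,
      RingHom.comp_id, ← MvPolynomial.eval_map, ha, map_mul, MvPolynomial.eval_C] at h1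
    exact (mul_eq_zero.1 h1).resolve_left ((map_ne_zero_iff _ hinj).2 hc)
end
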